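/- For every finite projective plane Π of order q, C_8(Π) = (q^2 + q + 1)(q^2 + q)q^2(q - 1)^2(q - 5)(q^7 - 43q^6 + 788q^5 - 7937q^4 + 47097q^3 - 162834q^2 + 299280q - 222960) - 8(q^2 - 20q + 78)·A_7(Π) + A_8(Π). -/

import Mathlib

open scoped Classical

structure ProjPlane (q : ℕ) where
  Point : Type
  fintypePoint : Fintype Point
  L : Set (Set Point)
  unique_line : ∀ p₁ p₂ : Point, p₁ ≠ p₂ → ∃! ℓ, ℓ ∈ L ∧ p₁ ∈ ℓ ∧ p₂ ∈ ℓ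
  unique_point : ∀ ℓ₁ ℓ₂, ℓ₁ ∈ L → ℓ₂ ∈ L → ℓ₁ ≠ ℓ₂ → ∃! p, p ∈ ℓ₁ ∧ p ∈ ℓ₂
  nondegenerate : ∃ a b c d : Point, a ≠ b ∧ a ≠ c ∧ a ≠ d ∧ b ≠ c ∧ b ≠ d ∧ c ≠ d ∧
    ∀ ℓ ∈ L, ¬({a, b, c} ⊆ ℓ) ∧ ¬({a, b, d} ⊆ ℓ) ∧ ¬({a, c, d} ⊆ ℓ) ∧ ¬({b, c, d} ⊆ ℓ)
  line_card : ∀ ℓ ∈ L, ℓ.ncard = q + 1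
  point_card : ∀ p : Point, {ℓ ∈ L | p ∈ ℓ}.ncard = q + 1

/-- A set of points is collinear if it is contained in a line. -/
noncomputable def ProjPlane.Collinear {q : ℕ} (Pl : ProjPlane q) (s : Set Pl.Point) : Prop :=
  ∃ ℓ ∈ Pl.L, s ⊆ ℓ

/-- The number of ordered `n`-arcs of the plane. -/
noncomputable def ProjPlane.nArcs {q : ℕ} (Pl : ProjPlane q) (n : ℕ) : ℕ :=
  Nat.card {p : Fin n → Pl.Point // Function.Injective p ∧
    ∀ i j k : Fin n, i ≠ j → i ≠ k → j ≠ k → ¬ Pl.Collinear {p i, p j, p k}}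

/-- Number of ordered strong realizations of the Fano plane. -/
noncomputable def ProjPlane.A7 {q : ℕ} (Pl : ProjPlane q) : ℕ :=
  Nat.card {p : ZMod 7 → Pl.Point // Function.Injective p ∧
    ∃ σ : Equiv.Perm (ZMod 7), ∀ i j k : ZMod 7, i ≠ j → i ≠ k → j ≠ k →
      (Pl.Collinear {p (σ i), p (σ j), p (σ k)} ↔
        ∃ a : ZMod 7, ({i, j, k} : Set (ZMod 7)) = {a, a + 1, a + 3})}

/-- Number of ordered strong realizations of the Möbius–Kantor configuration. -/
noncomputable def ProjPlane.A8 {q : ℕ} (Pl : ProjPlane q) : ℕ :=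
  Nat.card {p : ZMod 8 → Pl.Point // Function.Injective p ∧
    ∃ σ : Equiv.Perm (ZMod 8), ∀ i j k : ZMod 8, i ≠ j → i ≠ k → j ≠ k →
      (Pl.Collinear {p (σ i), p (σ j), p (σ k)} ↔
        ∃ a : ZMod 8, ({i, j, k} : Set (ZMod 8)) = {a, a + 1, a + 3})}

namespace Configuration

open Finset ProjectivePlane

section Definitions

variable {P : Type*} (L : Type*) [Membership P L] {n : ℕ}

/-- Three points, possibly with repetitions, lie on a common line. -/
def Col (a b c : P) : Prop := ∃ l : L, a ∈ l ∧ b ∈ l ∧ c ∈ l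

/-- An ordered arc. -/
def IsArc (K : Fin n → P) : Prop :=
  Function.Injective K ∧ ∀ i j k, i ≠ j → i ≠ k → j ≠ k → ¬ Col L (K i) (K j) (K k)

/-- The lines joining the pairs of points of `K` indexed by `T` share a point. -/
def Conc (K : Fin n → P) (T : Finset (Fin n × Fin n)) : Prop :=
  ∃ x, ∀ e ∈ T, Col L (K e.1) (K e.2) x

/-- The increasing pairs of indices. -/
def pairs (n : ℕ) : Finset (Fin n × Fin n) := {e | e.1 < e.2}

/-- Two pairs of indices have no index in common. -/
abbrev Apart (e f : Fin n × Fin n) : Prop :=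
  e.1 ≠ f.1 ∧ e.1 ≠ f.2 ∧ e.2 ≠ f.1 ∧ e.2 ≠ f.2

/-- The matchings with `k` edges in the complete graph on `n` vertices. -/
def matchings (n k : ℕ) : Finset (Finset (Fin n × Fin n)) :=
  {T ∈ (pairs n).powersetCard k | ∀ e ∈ T, ∀ f ∈ T, e ≠ f → Apart e f}

end Definitions

section Incidence

variable {P L : Type*} [Membership P L]

theorem Col.swap_left {a b c : P} (h : Col L a b c) : Col L b a c := by
  obtain ⟨l, h⟩ := h; exact ⟨l, h.2.1, h.1, h.2.2⟩

theorem Col.swap_right {a b c : P} (h : Col L a b c) : Col L a c b := by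
  obtain ⟨l, h⟩ := h; exact ⟨l, h.1, h.2.2, h.2.1⟩

variable [ProjectivePlane P L]

theorem exists_line_through (a b : P) : ∃ l : L, a ∈ l ∧ b ∈ l := by
  by_cases h : a = b
  · subst h
    obtain ⟨p, -, -, -, -, -, -, -⟩ := exists_config (P := P) (L := L)
    by_cases hp : a = p
    · obtain ⟨l, hl⟩ := Nondegenerate.exists_line (L := L) a
      obtain ⟨p', q', r', l₁, l₂, l₃, h1, h2, h3, h4, h5, -⟩ := exists_config (P := P) (L := L)
      by_cases h' : a = q'
      · exact ⟨l₂, h' ▸ h4, h' ▸ h4⟩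
      · exact ⟨HasLines.mkLine h', (HasLines.mkLine_ax h').1, (HasLines.mkLine_ax h').1⟩
    · exact ⟨HasLines.mkLine hp, (HasLines.mkLine_ax hp).1, (HasLines.mkLine_ax hp).1⟩
  · exact ⟨HasLines.mkLine h, HasLines.mkLine_ax h⟩

theorem exists_point_on (l m : L) : ∃ p : P, p ∈ l ∧ p ∈ m := by
  by_cases h : l = m
  · subst h
    obtain ⟨m, hm⟩ : ∃ m : L, m ≠ l := by
      obtain ⟨p', q', r', l₁, l₂, l₃, h1, h2, h3, h4, h5, -⟩ := exists_config (P := P) (L := L)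
      by_cases h' : l₁ = l
      · exact ⟨l₂, by rintro rfl; exact h3 (h' ▸ h4)⟩
      · exact ⟨l₁, h'⟩
    exact ⟨HasPoints.mkPoint hm, (HasPoints.mkPoint_ax hm).2, (HasPoints.mkPoint_ax hm).2⟩
  · exact ⟨HasPoints.mkPoint h, HasPoints.mkPoint_ax h⟩

theorem eq_of_mem {a b : P} {l m : L} (hab : a ≠ b) (hal : a ∈ l) (hbl : b ∈ l) (ham : a ∈ m)
    (hbm : b ∈ m) : l = m :=
  (Nondegenerate.eq_or_eq hal hbl ham hbm).resolve_left hab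

theorem eq_or_eq_of_mem {a b : P} {l m : L} (hal : a ∈ l) (hbl : b ∈ l) (ham : a ∈ m)
    (hbm : b ∈ m) : a = b ∨ l = m :=
  Nondegenerate.eq_or_eq hal hbl ham hbm

theorem col_self_left (a b : P) : Col L a a b := by
  obtain ⟨l, h⟩ := exists_line_through (L := L) a b
  exact ⟨l, h.1, h.1, h.2⟩

theorem Col.mem {a b c : P} {l : L} (h : Col L a b c) (hab : a ≠ b) (ha : a ∈ l) (hb : b ∈ l) :
    c ∈ l := by
  obtain ⟨m, h⟩ := h
  exact eq_of_mem hab h.1 h.2.1 ha hb ▸ h.2.2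

variable [Fintype P] [Finite L]

theorem card_points_int : (Fintype.card P : ℤ) = (order P L : ℤ) ^ 2 + order P L + 1 := by
  exact_mod_cast card_points P L

theorem card_mem (l : L) : #{x : P | x ∈ l} = order P L + 1 := by
  rw [← pointCount_eq (P := P) l, pointCount, Nat.card_eq_fintype_card, Fintype.card_subtype]

end Incidence

section Extension

variable {P L : Type*} [Membership P L] {n : ℕ}

theorem isArc_snoc {K : Fin n → P} {x : P} :
    IsArc L (Fin.snoc (α := fun _ => P) K x) ↔
      IsArc L K ∧ x ∉ Set.range K ∧ ∀ e ∈ pairs n, ¬ Col L (K e.1) (K e.2) x := by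
  constructor
  · rintro ⟨hi, hc⟩
    refine ⟨⟨fun i j hij => ?_, fun i j k h1 h2 h3 => ?_⟩, ?_, fun e he => ?_⟩
    · have := @hi i.castSucc j.castSucc (by simpa using hij)
      simpa using this
    · have := hc i.castSucc j.castSucc k.castSucc (by simpa) (by simpa) (by simpa)
      simpa using this
    · rintro ⟨i, rfl⟩
      have := @hi i.castSucc (Fin.last n) (by simp)
      exact (Fin.castSucc_lt_last i).ne this
    · have he : e.1 < e.2 := by simpa [pairs] using he
      have := hc e.1.castSucc e.2.castSucc (Fin.last n) (by simpa using he.ne)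
        (Fin.castSucc_lt_last _).ne (Fin.castSucc_lt_last _).ne
      simpa using this
  · rintro ⟨⟨hi, hc⟩, hx, he⟩
    have he : ∀ i j, i ≠ j → ¬ Col L (K i) (K j) x := by
      intro i j hij hcol
      rcases lt_or_gt_of_ne hij with h | h
      · exact he (i, j) (by simpa [pairs]) hcol
      · exact he (j, i) (by simpa [pairs]) hcol.swap_left
    refine ⟨Fin.snoc_injective_iff.2 ⟨hi, hx⟩, fun i j k => ?_⟩
    refine Fin.lastCases ?_ (fun i => ?_) i <;> refine Fin.lastCases ?_ (fun j => ?_) j <;>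
      refine Fin.lastCases ?_ (fun k => ?_) k <;> intro h1 h2 h3 <;>
      simp only [Fin.snoc_last, Fin.snoc_castSucc, ne_eq, Fin.castSucc_inj, not_true] at *
    · exact fun h => he _ _ h3 h.swap_left.swap_right
    · exact fun h => he _ _ h2 h.swap_right
    · exact he _ _ h1
    · exact hc _ _ _ h1 h2 h3

theorem IsArc.off_of_apart (hK : IsArc L K) {e f : Fin n × Fin n} (he : e ∈ pairs n)
    (hf : f ∈ pairs n) (hef : Apart e f) {x : P} (h1 : Col L (K e.1) (K e.2) x)
    (h2 : Col L (K f.1) (K f.2) x) : x ∉ Set.range K := by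
  have he : e.1 < e.2 := by simpa [pairs] using he
  have hf : f.1 < f.2 := by simpa [pairs] using hf
  rintro ⟨i, rfl⟩
  by_cases hi : i = e.1 ∨ i = e.2
  · exact hK.2 f.1 f.2 i hf.ne (by grind) (by grind) h2
  · exact hK.2 e.1 e.2 i he.ne (by grind) (by grind) h1

theorem IsArc.not_both (hK : IsArc L K) {e f : Fin n × Fin n} (he : e ∈ pairs n)
    (hef : Apart e f) {l : L} (h1 : K e.1 ∈ l) (h2 : K e.2 ∈ l) (h3 : K f.1 ∈ l) : False := by
  have he : e.1 < e.2 := by simpa [pairs] using he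
  exact hK.2 e.1 e.2 f.1 he.ne hef.1 hef.2.2.1 ⟨l, h1, h2, h3⟩

theorem sum_choose_secants (K : Fin n → P) (s : Finset P) (k : ℕ) :
    ∑ x ∈ s, (#{e ∈ pairs n | Col L (K e.1) (K e.2) x}).choose k =
      ∑ T ∈ (pairs n).powersetCard k, #{x ∈ s | ∀ e ∈ T, Col L (K e.1) (K e.2) x} := by
  simp_rw [← card_powersetCard]
  have : ∀ x, (powersetCard k {e ∈ pairs n | Col L (K e.1) (K e.2) x}) =
      {T ∈ (pairs n).powersetCard k | ∀ e ∈ T, Col L (K e.1) (K e.2) x} := by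
    intro x
    ext T
    simp only [mem_powersetCard, mem_filter, subset_iff]
    grind
  simp_rw [this]
  exact sum_card_bipartiteAbove_eq_sum_card_bipartiteBelow _

variable [ProjectivePlane P L]

theorem isArc_of_lt (hn : 3 ≤ n) {K : Fin n → P}
    (h : ∀ i j k, i < j → j < k → ¬ Col L (K i) (K j) (K k)) : IsArc L K := by
  have h3 : ∀ i j k, i ≠ j → i ≠ k → j ≠ k → ¬ Col L (K i) (K j) (K k) := by
    intro i j k hij hik hjk hc
    rcases lt_or_gt_of_ne hij with h1 | h1 <;> rcases lt_or_gt_of_ne hik with h2 | h2 <;>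
      rcases lt_or_gt_of_ne hjk with h3 | h3
    · exact h _ _ _ h1 h3 hc
    · exact h _ _ _ h2 h3 hc.swap_right
    · exact absurd (h1.trans h3) h2.asymm
    · exact h _ _ _ h2 h1 hc.swap_right.swap_left
    · exact h _ _ _ h1 h2 hc.swap_left
    · exact absurd (h3.trans h1) h2.asymm
    · exact h _ _ _ h3 h2 hc.swap_left.swap_right
    · exact h _ _ _ h3 h1 hc.swap_left.swap_right.swap_left
  refine ⟨fun i j hij => ?_, h3⟩
  by_contra hne
  obtain ⟨k, hk⟩ : ∃ k, k ∉ ({i, j} : Finset (Fin n)) := by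
    by_contra! hc
    have := Finset.card_le_card (fun k _ => hc k : (univ : Finset (Fin n)) ⊆ {i, j})
    have h2 := Finset.card_le_two (a := i) (b := j)
    simp at this
    omega
  simp only [mem_insert, mem_singleton, not_or] at hk
  exact h3 i j k hne (Ne.symm hk.1) (Ne.symm hk.2) (hij ▸ col_self_left _ _)

variable {K : Fin n → P}

theorem IsArc.apart (hK : IsArc L K) {e f : Fin n × Fin n} (he : e ∈ pairs n) (hf : f ∈ pairs n)
    (hef : e ≠ f) {x : P} (hx : x ∉ Set.range K) (h1 : Col L (K e.1) (K e.2) x)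
    (h2 : Col L (K f.1) (K f.2) x) : Apart e f := by
  have key : ∀ i j k, i ≠ j → i ≠ k → Col L (K i) (K j) x → Col L (K i) (K k) x → j = k := by
    rintro i j k hij hik ⟨l, a1, a2, a3⟩ ⟨m, b1, b2, b3⟩
    by_contra hjk
    have : l = m := eq_of_mem (fun h => hx ⟨i, h⟩) a1 a3 b1 b3
    subst this
    exact hK.2 i j k hij hik hjk ⟨l, a1, a2, b2⟩
  obtain ⟨i, j⟩ := e
  obtain ⟨k, m⟩ := f
  have he : i < j := by simpa [pairs] using he
  have hf : k < m := by simpa [pairs] using hf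
  refine ⟨?_, ?_, ?_, ?_⟩ <;> intro h <;> simp only at h <;> subst h
  · exact hef (by rw [key _ _ _ he.ne hf.ne h1 h2])
  · have := key _ _ _ he.ne hf.ne' h1 h2.swap_left
    exact absurd (he.trans_eq this) hf.asymm
  · have := key _ _ _ he.ne' hf.ne h1.swap_left h2
    exact absurd (he.trans hf) (this ▸ lt_irrefl _)
  · exact hef (by rw [key _ _ _ he.ne' hf.ne' h1.swap_left h2.swap_left])

theorem IsArc.eq_of_apart (hK : IsArc L K) {e f : Fin n × Fin n} (he : e ∈ pairs n)
    (hf : f ∈ pairs n) (hef : Apart e f) {x y : P} (h1 : Col L (K e.1) (K e.2) x)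
    (h2 : Col L (K f.1) (K f.2) x) (h3 : Col L (K e.1) (K e.2) y)
    (h4 : Col L (K f.1) (K f.2) y) : x = y := by
  have he' : e.1 < e.2 := by simpa [pairs] using he
  have hf' : f.1 < f.2 := by simpa [pairs] using hf
  obtain ⟨l, a1, a2, a3⟩ := h1
  obtain ⟨m, b1, b2, b3⟩ := h2
  have c := h3.mem (hK.1.ne he'.ne) a1 a2
  have d := h4.mem (hK.1.ne hf'.ne) b1 b2
  rcases Nondegenerate.eq_or_eq a3 c b3 d with h | h
  · exact h
  · subst h
    exact (hK.not_both he hef a1 a2 b1).elim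

theorem IsArc.card_secants_le (hK : IsArc L K) {x : P} (hx : x ∉ Set.range K) :
    2 * #{e ∈ pairs n | Col L (K e.1) (K e.2) x} ≤ n := by
  have h := card_biUnion (s := {e ∈ pairs n | Col L (K e.1) (K e.2) x})
    (t := fun e => ({e.1, e.2} : Finset (Fin n))) (by
      intro e he f hf hef
      simp only [coe_filter, Set.mem_ofPred_eq] at he hf
      have := hK.apart he.1 hf.1 hef hx he.2 hf.2
      simp only [disjoint_left, mem_insert, mem_singleton]
      grind)
  rw [sum_const_nat (m := 2)] at h
  · have := card_le_univ
      ({e ∈ pairs n | Col L (K e.1) (K e.2) x}.biUnion fun e => ({e.1, e.2} : Finset (Fin n)))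
    simp only [Fintype.card_fin] at this
    omega
  · intro e he
    have : e.1 < e.2 := by simpa [pairs] using (mem_filter.1 he).1
    exact card_pair this.ne

variable [Fintype P]

theorem IsArc.card_off_conc (hK : IsArc L K) {k : ℕ} (hk : 2 ≤ k) {T : Finset (Fin n × Fin n)}
    (hT : T ∈ (pairs n).powersetCard k) :
    #{x ∈ ({x | x ∉ Set.range K} : Finset P) | ∀ e ∈ T, Col L (K e.1) (K e.2) x} =
      if (∀ e ∈ T, ∀ f ∈ T, e ≠ f → Apart e f) ∧ Conc L K T then 1 else 0 := by
  rw [mem_powersetCard] at hT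
  obtain ⟨e, he, f, hf, hef⟩ := one_lt_card.1 (by omega : 1 < #T)
  split_ifs with h
  · obtain ⟨hA, x, hx⟩ := h
    rw [card_eq_one]
    refine ⟨x, ?_⟩
    ext y
    simp only [mem_filter, mem_univ, true_and, mem_singleton]
    constructor
    · rintro ⟨-, hy⟩
      exact hK.eq_of_apart (hT.1 he) (hT.1 hf) (hA e he f hf hef) (hy e he) (hy f hf) (hx e he)
        (hx f hf)
    · rintro rfl
      exact ⟨hK.off_of_apart (hT.1 he) (hT.1 hf) (hA e he f hf hef) (hx e he) (hx f hf), hx⟩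
  · rw [card_eq_zero, filter_eq_empty_iff]
    intro x hx hc
    simp only [mem_filter, mem_univ, true_and] at hx
    exact h ⟨fun e he f hf hef => hK.apart (hT.1 he) (hT.1 hf) hef hx (hc e he) (hc f hf), x, hc⟩

variable [Finite L]

theorem IsArc.card_off_secant (hK : IsArc L K) {e : Fin n × Fin n} (he : e ∈ pairs n) :
    (#{x ∈ ({x | x ∉ Set.range K} : Finset P) | Col L (K e.1) (K e.2) x} : ℤ) =
      order P L - 1 := by
  have he' : e.1 < e.2 := by simpa [pairs] using he
  obtain ⟨l, h1, h2⟩ := exists_line_through (L := L) (K e.1) (K e.2)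
  have : ({x ∈ ({x | x ∉ Set.range K} : Finset P) | Col L (K e.1) (K e.2) x}) =
      ({x | x ∈ l} : Finset P) \ {K e.1, K e.2} := by
    ext x
    simp only [mem_filter, mem_univ, true_and, mem_sdiff, mem_insert, mem_singleton, not_or]
    constructor
    · rintro ⟨hx, hc⟩
      exact ⟨hc.mem (hK.1.ne he'.ne) h1 h2, fun h => hx ⟨_, h.symm⟩, fun h => hx ⟨_, h.symm⟩⟩
    · rintro ⟨hx, hx1, hx2⟩
      refine ⟨?_, l, h1, h2, hx⟩
      rintro ⟨i, rfl⟩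
      exact hK.2 e.1 e.2 i he'.ne (fun h => hx1 (h ▸ rfl)) (fun h => hx2 (h ▸ rfl))
        ⟨l, h1, h2, hx⟩
  rw [this, cast_card_sdiff (by simp [insert_subset_iff, h1, h2]), card_mem,
    card_pair (hK.1.ne he'.ne)]
  push_cast
  ring

/-- The number of points extending an arc with at most seven points to a larger arc. -/
theorem IsArc.card_snoc (hK : IsArc L K) (hn : n ≤ 7) :
    (#{x | IsArc L (Fin.snoc (α := fun _ => P) K x)} : ℤ) =
      (order P L : ℤ) ^ 2 + order P L + 1 - n - #(pairs n) * ((order P L : ℤ) - 1) +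
        #(matchings n 2) - #{T ∈ matchings n 3 | Conc L K T} := by
  set s : Finset P := {x | x ∉ Set.range K} with hs
  set d : P → ℕ := fun x => #{e ∈ pairs n | Col L (K e.1) (K e.2) x} with hd
  have h1 : (#{x | IsArc L (Fin.snoc (α := fun _ => P) K x)} : ℤ) =
      ∑ x ∈ s, (1 - ((d x).choose 1 : ℤ) + (d x).choose 2 - (d x).choose 3) := by
    have : ({x | IsArc L (Fin.snoc (α := fun _ => P) K x)} : Finset P) = {x ∈ s | d x = 0} := by
      ext x
      simp [isArc_snoc, hK, hs, hd, filter_eq_empty_iff]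
    rw [this, card_filter]
    push_cast
    refine sum_congr rfl fun x hx => ?_
    have h2 : d x ≤ 3 := by
      have := hK.card_secants_le (x := x) (by simpa [hs] using hx)
      simp only [hd]
      omega
    interval_cases d x <;> simp [Nat.choose]
  have hsec : ∀ k, (∑ x ∈ s, ((d x).choose k : ℤ)) =
      ∑ T ∈ (pairs n).powersetCard k, (#{x ∈ s | ∀ e ∈ T, Col L (K e.1) (K e.2) x} : ℤ) := by
    intro k
    exact_mod_cast sum_choose_secants (L := L) K s k
  have hk : ∀ k, 2 ≤ k → (∑ x ∈ s, ((d x).choose k : ℤ)) = #{T ∈ matchings n k | Conc L K T} := by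
    intro k hk
    rw [hsec, matchings, filter_filter, card_filter]
    push_cast
    refine sum_congr rfl fun T hT => ?_
    rw [hK.card_off_conc hk hT]
    push_cast
    rfl
  have hcs : (#s : ℤ) = (order P L : ℤ) ^ 2 + order P L + 1 - n := by
    have : s = univ \ univ.image K := by
      ext x
      simp [hs]
    rw [this, cast_card_sdiff (subset_univ _), card_univ, card_points_int (L := L),
      card_image_of_injective _ hK.1, card_univ, Fintype.card_fin]
  have h2 : {T ∈ matchings n 2 | Conc L K T} = matchings n 2 := by
    rw [filter_eq_self]
    intro T hT
    simp only [matchings, mem_filter, mem_powersetCard] at hT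
    obtain ⟨e, f, hef, rfl⟩ := card_eq_two.1 hT.1.2
    obtain ⟨l, a1, a2⟩ := exists_line_through (L := L) (K e.1) (K e.2)
    obtain ⟨m, b1, b2⟩ := exists_line_through (L := L) (K f.1) (K f.2)
    obtain ⟨x, hl, hm⟩ := exists_point_on (P := P) l m
    refine ⟨x, fun g hg => ?_⟩
    simp only [mem_insert, mem_singleton] at hg
    rcases hg with rfl | rfl
    · exact ⟨l, a1, a2, hl⟩
    · exact ⟨m, b1, b2, hm⟩
  have h0 : (∑ x ∈ s, ((d x).choose 1 : ℤ)) = #(pairs n) * ((order P L : ℤ) - 1) := by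
    rw [hsec, powersetCard_one, sum_map, ← nsmul_eq_mul]
    refine sum_eq_card_nsmul fun e he => ?_
    have := hK.card_off_secant he
    simpa [hs] using this
  rw [h1, sum_sub_distrib, sum_add_distrib, sum_sub_distrib, h0, hk 2 le_rfl, hk 3 (by norm_num),
    h2, sum_const, nsmul_one, hcs]

end Extension

section Matchings

/-- The matching `{01, 23, 45}`, in each complete graph on at least six vertices. -/
def stdMatching (n : ℕ) [NeZero n] : Finset (Fin n × Fin n) :=
  {(Fin.ofNat n 0, Fin.ofNat n 1), (Fin.ofNat n 2, Fin.ofNat n 3), (Fin.ofNat n 4, Fin.ofNat n 5)}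

/-- A matching of the complete graph on six vertices with `j` edges in common with
`stdMatching 6`, for `j = 0, 1, 3`. -/
def meetingMatching : ℕ → Finset (Fin 6 × Fin 6)
  | 0 => {(1, 2), (3, 4), (5, 0)}
  | 1 => {(0, 2), (1, 3), (4, 5)}
  | _ => stdMatching 6

/-- The map `s` of vertices takes the edges in `S` to the edges in `T`. -/
def MapsMatching {n : ℕ} (s : Fin n → Fin n) (S T : Finset (Fin n × Fin n)) : Prop :=
  (∀ e ∈ S, (s e.1, s e.2) ∈ T ∨ (s e.2, s e.1) ∈ T) ∧
    ∀ e ∈ T, ∃ f ∈ S, (s f.1, s f.2) = e ∨ (s f.2, s f.1) = e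

instance {n : ℕ} (s : Fin n → Fin n) (S T : Finset (Fin n × Fin n)) :
    Decidable (MapsMatching s S T) := by
  unfold MapsMatching
  infer_instance

theorem card_matchings_three_seven : #(matchings 7 3) = 105 := by decide +kernel
theorem card_matchings_two_seven : #(matchings 7 2) = 105 := by decide +kernel
theorem card_matchings_three_six : #(matchings 6 3) = 15 := by decide +kernel
theorem card_matchings_two_six : #(matchings 6 2) = 45 := by decide +kernel

theorem exists_mapsMatching {n : ℕ} [NeZero n] (hn : 6 ≤ n) {T : Finset (Fin n × Fin n)}
    (hT : T ∈ matchings n 3) : ∃ s : Equiv.Perm (Fin n), MapsMatching s (stdMatching n) T := by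
  simp only [matchings, mem_filter, mem_powersetCard] at hT
  obtain ⟨⟨hsub, hcard⟩, hap⟩ := hT
  obtain ⟨e, f, g, hef, heg, hfg, rfl⟩ := card_eq_three.1 hcard
  have he : e.1 < e.2 := by simpa [pairs] using hsub (by simp : e ∈ _)
  have hf : f.1 < f.2 := by simpa [pairs] using hsub (by simp : f ∈ _)
  have hg : g.1 < g.2 := by simpa [pairs] using hsub (by simp : g ∈ _)
  have h1 := hap e (by simp) f (by simp) hef
  have h2 := hap e (by simp) g (by simp) heg
  have h3 := hap f (by simp) g (by simp) hfg
  have hinj : Function.Injective ![e.1, e.2, f.1, f.2, g.1, g.2] := by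
    intro i j
    fin_cases i <;> fin_cases j <;> simp <;> grind
  obtain ⟨s, hs⟩ := (Equiv.Perm.isMultiplyPretransitive (Fin n) 6).exists_smul_eq
    (Fin.castLEEmb hn) ⟨_, hinj⟩
  have hs : ∀ i : Fin 6, s (Fin.ofNat n i) = ![e.1, e.2, f.1, f.2, g.1, g.2] i := by
    intro i
    rw [show Fin.ofNat n i = Fin.castLE hn i from
      Fin.ext (Nat.mod_eq_of_lt (i.isLt.trans_le hn))]
    exact DFunLike.congr_fun hs i
  have s0 : s (Fin.ofNat n 0) = e.1 := hs 0
  have s1 : s (Fin.ofNat n 1) = e.2 := hs 1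
  have s2 : s (Fin.ofNat n 2) = f.1 := hs 2
  have s3 : s (Fin.ofNat n 3) = f.2 := hs 3
  have s4 : s (Fin.ofNat n 4) = g.1 := hs 4
  have s5 : s (Fin.ofNat n 5) = g.2 := hs 5
  refine ⟨s, ?_, ?_⟩ <;>
    simp only [stdMatching, mem_insert, mem_singleton, forall_eq_or_imp, forall_eq,
      exists_eq_or_imp, exists_eq_left, s0, s1, s2, s3, s4, s5, Prod.mk.eta, true_or, or_true,
      and_self]

theorem matchings_six_three : matchings 6 3 =
    {{(0, 1), (2, 3), (4, 5)}, {(0, 1), (2, 4), (3, 5)}, {(0, 1), (2, 5), (3, 4)},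
      {(0, 2), (1, 3), (4, 5)}, {(0, 2), (1, 4), (3, 5)}, {(0, 2), (1, 5), (3, 4)},
      {(0, 3), (1, 2), (4, 5)}, {(0, 3), (1, 4), (2, 5)}, {(0, 3), (1, 5), (2, 4)},
      {(0, 4), (1, 2), (3, 5)}, {(0, 4), (1, 3), (2, 5)}, {(0, 4), (1, 5), (2, 3)},
      {(0, 5), (1, 2), (3, 4)}, {(0, 5), (1, 3), (2, 4)}, {(0, 5), (1, 4), (2, 3)}} := by
  decide +kernel

theorem exists_mapsMatching_six {T : Finset (Fin 6 × Fin 6)} (hT : T ∈ matchings 6 3) :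
    ∃ s : Equiv.Perm (Fin 6), MapsMatching s (stdMatching 6) (stdMatching 6) ∧
      MapsMatching s (meetingMatching #(T ∩ stdMatching 6)) T := by
  have h : ∃ s ∈ ([![0, 1, 2, 3, 4, 5], ![0, 1, 3, 2, 4, 5],
      ![0, 1, 4, 5, 2, 3], ![0, 1, 5, 4, 2, 3], ![2, 3, 4, 5, 1, 0], ![2, 3, 5, 4, 0, 1],
      ![0, 1, 3, 2, 5, 4], ![0, 1, 4, 5, 3, 2]] : List (Fin 6 → Fin 6)), (∀ i, ∃ j, s j = i) ∧
      MapsMatching s (stdMatching 6) (stdMatching 6) ∧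
      MapsMatching s (meetingMatching #(T ∩ stdMatching 6)) T := by
    rw [matchings_six_three] at hT
    simp only [mem_insert, mem_singleton] at hT
    rcases hT with rfl | rfl | rfl | rfl | rfl | rfl | rfl | rfl | rfl | rfl | rfl | rfl | rfl |
      rfl | rfl <;> decide +kernel
  obtain ⟨s, -, hs, h1, h2⟩ := h
  exact ⟨Equiv.ofBijective s (Function.Surjective.bijective_of_finite hs), h1, h2⟩

theorem sum_matchings_six (b : ℕ → ℤ) :
    ∑ T ∈ matchings 6 3, b #(T ∩ stdMatching 6) = 8 * b 0 + 6 * b 1 + b 3 := by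
  have h : (matchings 6 3).val.map (fun T => #(T ∩ stdMatching 6)) =
      {3, 1, 1, 1, 1, 1, 1, 0, 0, 0, 0, 0, 0, 0, 0} := by
    rw [matchings_six_three]
    decide +kernel
  have h' := congrArg (Multiset.map b) h
  rw [Multiset.map_map] at h'
  rw [Finset.sum_eq_multiset_sum]
  refine (congrArg Multiset.sum h').trans ?_
  simp only [Multiset.insert_eq_cons, Multiset.map_cons, Multiset.map_singleton,
    Multiset.sum_cons, Multiset.sum_singleton]
  ring

end Matchings

section Relabelling

variable {P L : Type*} [Membership P L] {n : ℕ}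

theorem isArc_comp (s : Equiv.Perm (Fin n)) (K : Fin n → P) : IsArc L (K ∘ s) ↔ IsArc L K := by
  constructor
  · rintro ⟨hi, hc⟩
    refine ⟨fun i j h => ?_, fun i j k h1 h2 h3 => ?_⟩
    · have := @hi (s.symm i) (s.symm j) (by simpa)
      simpa using this
    · simpa using hc (s.symm i) (s.symm j) (s.symm k) (by simpa) (by simpa) (by simpa)
  · rintro ⟨hi, hc⟩
    exact ⟨hi.comp s.injective, fun i j k h1 h2 h3 => hc _ _ _ (s.injective.ne h1)
      (s.injective.ne h2) (s.injective.ne h3)⟩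

theorem conc_comp_iff (K : Fin n → P) {s : Fin n → Fin n} {S T : Finset (Fin n × Fin n)}
    (h : MapsMatching s S T) : Conc L (K ∘ s) S ↔ Conc L K T := by
  constructor
  · rintro ⟨x, hx⟩
    refine ⟨x, fun e he => ?_⟩
    obtain ⟨f, hf, rfl | rfl⟩ := h.2 e he
    · exact hx f hf
    · exact (hx f hf).swap_left
  · rintro ⟨x, hx⟩
    refine ⟨x, fun e he => ?_⟩
    rcases h.1 e he with h | h
    · exact hx _ h
    · exact (hx _ h).swap_left

variable [Fintype P]

theorem card_filter_comp (s : Equiv.Perm (Fin n)) (Q : (Fin n → P) → Prop) [DecidablePred Q] :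
    #{K : Fin n → P | Q (K ∘ s)} = #{K : Fin n → P | Q K} := by
  refine card_equiv (s.symm.arrowCongr (Equiv.refl P)) fun K => ?_
  simp only [mem_filter, mem_univ, true_and]
  rfl

theorem card_filter_snoc (S : (Fin (n + 1) → P) → Prop) [DecidablePred S] :
    #{K : Fin (n + 1) → P | S K} =
      ∑ K : Fin n → P, #{x | S (Fin.snoc (α := fun _ => P) K x)} := by
  rw [← card_sigma]
  refine card_bij' (fun K _ => ⟨Fin.init (α := fun _ => P) K, K (Fin.last n)⟩)
    (fun p _ => Fin.snoc (α := fun _ => P) p.1 p.2) ?_ ?_ ?_ ?_ <;> simp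

theorem sum_card_conc [NeZero n] (hn : 6 ≤ n) :
    ∑ K ∈ {K : Fin n → P | IsArc L K}, #{T ∈ matchings n 3 | Conc L K T} =
      #(matchings n 3) * #{K : Fin n → P | IsArc L K ∧ Conc L K (stdMatching n)} := by
  have := sum_card_bipartiteAbove_eq_sum_card_bipartiteBelow (s := {K : Fin n → P | IsArc L K})
    (t := matchings n 3) (r := fun K T => Conc L K T)
  simp only [bipartiteAbove, bipartiteBelow, filter_filter] at this
  rw [this, ← smul_eq_mul]
  refine sum_eq_card_nsmul fun T hT => ?_
  obtain ⟨s, hs⟩ := exists_mapsMatching hn hT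
  rw [← card_filter_comp s fun K => IsArc L K ∧ Conc L K (stdMatching n)]
  congr 1
  ext K
  simp only [mem_filter, mem_univ, true_and, isArc_comp, conc_comp_iff _ hs]

theorem sum_card_conc_six :
    (∑ K ∈ {K : Fin 6 → P | IsArc L K ∧ Conc L K (stdMatching 6)},
      (#{T ∈ matchings 6 3 | Conc L K T} : ℤ)) =
      8 * #{K : Fin 6 → P | IsArc L K ∧ Conc L K (stdMatching 6) ∧
          Conc L K (meetingMatching 0)} +
        6 * #{K : Fin 6 → P | IsArc L K ∧ Conc L K (stdMatching 6) ∧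
          Conc L K (meetingMatching 1)} +
        #{K : Fin 6 → P | IsArc L K ∧ Conc L K (stdMatching 6)} := by
  have := sum_card_bipartiteAbove_eq_sum_card_bipartiteBelow
    (s := {K : Fin 6 → P | IsArc L K ∧ Conc L K (stdMatching 6)})
    (t := matchings 6 3) (r := fun K T => Conc L K T)
  simp only [bipartiteAbove, bipartiteBelow, filter_filter, and_assoc] at this
  have h3 : #{K : Fin 6 → P | IsArc L K ∧ Conc L K (stdMatching 6)} =
      #{K : Fin 6 → P | IsArc L K ∧ Conc L K (stdMatching 6) ∧ Conc L K (meetingMatching 3)} := by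
    simp [meetingMatching]
  rw [← Nat.cast_sum, this, h3, ← sum_matchings_six fun j => (#{K : Fin 6 → P | IsArc L K ∧
    Conc L K (stdMatching 6) ∧ Conc L K (meetingMatching j)} : ℤ)]
  push_cast
  refine sum_congr rfl fun T hT => ?_
  obtain ⟨s, hs, hsT⟩ := exists_mapsMatching_six hT
  rw [← card_filter_comp s fun K => IsArc L K ∧ Conc L K (stdMatching 6) ∧
    Conc L K (meetingMatching _)]
  congr 2
  ext K
  simp only [mem_filter, mem_univ, true_and, isArc_comp, conc_comp_iff _ hs, conc_comp_iff _ hsT]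

end Relabelling

section Recursion

variable {P L : Type*} [Membership P L] [Fintype P] {n : ℕ}

/-- The number of ordered `n`-arcs. -/
noncomputable def numArcs (P L : Type*) [Membership P L] [Fintype P] (n : ℕ) : ℤ :=
  #{K : Fin n → P | IsArc L K}

theorem numArcs_zero : numArcs P L 0 = 1 := by
  have : IsArc L (default : Fin 0 → P) := ⟨fun i => i.elim0, fun i => i.elim0⟩
  simp [numArcs, Subsingleton.elim _ (default : Fin 0 → P), this]

variable [ProjectivePlane P L] [Finite L]

theorem card_isArc_init (hn : n ≤ 7) (Q : (Fin n → P) → Prop) :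
    (#{K : Fin (n + 1) → P | IsArc L K ∧ Q (Fin.init (α := fun _ => P) K)} : ℤ) =
      #{K : Fin n → P | IsArc L K ∧ Q K} * ((order P L : ℤ) ^ 2 + order P L + 1 - n -
        #(pairs n) * ((order P L : ℤ) - 1) + #(matchings n 2)) -
      ∑ K ∈ {K : Fin n → P | IsArc L K ∧ Q K}, (#{T ∈ matchings n 3 | Conc L K T} : ℤ) := by
  have h (K : Fin n → P) : (#{x | IsArc L (Fin.snoc (α := fun _ => P) K x) ∧
        Q (Fin.init (α := fun _ => P) (Fin.snoc (α := fun _ => P) K x))} : ℤ) =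
      if IsArc L K ∧ Q K then (order P L : ℤ) ^ 2 + order P L + 1 - n -
        #(pairs n) * ((order P L : ℤ) - 1) + #(matchings n 2) -
        #{T ∈ matchings n 3 | Conc L K T} else 0 := by
    split_ifs with hK
    · rw [← hK.1.card_snoc hn]
      simp [hK.2]
    · rw [Nat.cast_eq_zero, card_eq_zero, filter_eq_empty_iff]
      rintro x - ⟨hx, hQ⟩
      exact hK ⟨(isArc_snoc.1 hx).1, by simpa using hQ⟩
  rw [card_filter_snoc, Nat.cast_sum, sum_congr rfl fun K _ => h K, ← sum_filter,
    sum_sub_distrib, sum_const, nsmul_eq_mul]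

theorem numArcs_succ (hn : n ≤ 7) :
    numArcs P L (n + 1) = numArcs P L n * ((order P L : ℤ) ^ 2 + order P L + 1 - n -
        #(pairs n) * ((order P L : ℤ) - 1) + #(matchings n 2)) -
      ∑ K ∈ {K : Fin n → P | IsArc L K}, (#{T ∈ matchings n 3 | Conc L K T} : ℤ) := by
  simpa [numArcs] using card_isArc_init (P := P) (L := L) hn fun _ => True

theorem numArcs_succ_of_le (hn : n ≤ 5) :
    numArcs P L (n + 1) = numArcs P L n * ((order P L : ℤ) ^ 2 + order P L + 1 - n -
        #(pairs n) * ((order P L : ℤ) - 1) + #(matchings n 2)) := by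
  have h : ∀ n ≤ 5, matchings n 3 = ∅ := by
    intro n hn
    interval_cases n <;> decide +kernel
  rw [numArcs_succ (hn.trans (by norm_num)), h n hn]
  simp

theorem numArcs_four : numArcs P L 4 =
    ((order P L : ℤ) ^ 2 + order P L + 1) * ((order P L : ℤ) ^ 2 + order P L) *
      (order P L : ℤ) ^ 2 * ((order P L : ℤ) - 1) ^ 2 := by
  have p0 : #(pairs 0) = 0 ∧ #(pairs 1) = 0 ∧ #(pairs 2) = 1 ∧ #(pairs 3) = 3 := by decide +kernel
  have m0 : #(matchings 0 2) = 0 ∧ #(matchings 1 2) = 0 ∧ #(matchings 2 2) = 0 ∧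
    #(matchings 3 2) = 0 := by decide +kernel
  rw [numArcs_succ_of_le (n := 3) (by norm_num), numArcs_succ_of_le (n := 2) (by norm_num),
    numArcs_succ_of_le (n := 1) (by norm_num), numArcs_succ_of_le (n := 0) (by norm_num),
    numArcs_zero, p0.1, p0.2.1, p0.2.2.1, p0.2.2.2, m0.1, m0.2.1, m0.2.2.1, m0.2.2.2]
  push_cast
  ring

theorem numArcs_five : numArcs P L 5 =
    numArcs P L 4 * (((order P L : ℤ) - 2) * ((order P L : ℤ) - 3)) := by
  have p : #(pairs 4) = 6 := by decide +kernel
  have m : #(matchings 4 2) = 3 := by decide +kernel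
  rw [numArcs_succ_of_le (n := 4) (by norm_num), p, m]
  push_cast
  ring

theorem numArcs_six : numArcs P L 6 =
    numArcs P L 5 * ((order P L : ℤ) ^ 2 - 9 * order P L + 21) := by
  have p : #(pairs 5) = 10 := by decide +kernel
  have m : #(matchings 5 2) = 15 := by decide +kernel
  rw [numArcs_succ_of_le (n := 5) (by norm_num), p, m]
  push_cast
  ring

theorem numArcs_seven : numArcs P L 7 =
    numArcs P L 6 * ((order P L : ℤ) ^ 2 - 14 * order P L + 55) -
      15 * #{K : Fin 6 → P | IsArc L K ∧ Conc L K (stdMatching 6)} := by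
  have p : #(pairs 6) = 15 := by decide +kernel
  rw [numArcs_succ (n := 6) (by norm_num), ← Nat.cast_sum, sum_card_conc le_rfl, p,
    card_matchings_three_six, card_matchings_two_six]
  push_cast
  ring

theorem numArcs_eight : numArcs P L 8 =
    numArcs P L 7 * ((order P L : ℤ) ^ 2 - 20 * order P L + 120) -
      105 * #{K : Fin 7 → P | IsArc L K ∧ Conc L K (stdMatching 7)} := by
  have p : #(pairs 7) = 21 := by decide +kernel
  rw [numArcs_succ (n := 7) (by norm_num), ← Nat.cast_sum, sum_card_conc (by norm_num), p,
    card_matchings_three_seven, card_matchings_two_seven]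
  push_cast
  ring

theorem card_conc_seven :
    (#{K : Fin 7 → P | IsArc L K ∧ Conc L K (stdMatching 7)} : ℤ) =
      #{K : Fin 6 → P | IsArc L K ∧ Conc L K (stdMatching 6)} *
          ((order P L : ℤ) ^ 2 - 14 * order P L + 54) -
        8 * #{K : Fin 6 → P | IsArc L K ∧ Conc L K (stdMatching 6) ∧
          Conc L K (meetingMatching 0)} -
        6 * #{K : Fin 6 → P | IsArc L K ∧ Conc L K (stdMatching 6) ∧
          Conc L K (meetingMatching 1)} := by
  have p : #(pairs 6) = 15 := by decide +kernel
  have h (K : Fin 7 → P) : Conc L K (stdMatching 7) ↔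
      Conc L (Fin.init (α := fun _ => P) K) (stdMatching 6) := by
    simp only [Conc, stdMatching, mem_insert, mem_singleton, forall_eq_or_imp, forall_eq]
    rfl
  simp only [h]
  rw [card_isArc_init (n := 6) (by norm_num) fun K => Conc L K (stdMatching 6),
    sum_card_conc_six, p, card_matchings_two_six]
  push_cast
  ring

end Recursion

section Diagonal

variable {P L : Type*} [Membership P L] [ProjectivePlane P L]

theorem col_iff_mem {a b c : P} {l : L} (hab : a ≠ b) (ha : a ∈ l) (hb : b ∈ l) :
    Col L a b c ↔ c ∈ l :=
  ⟨fun h => h.mem hab ha hb, fun h => ⟨l, ha, hb, h⟩⟩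

variable (L) in
/-- The point `x` lies on the line joining the diagonal points `ab ∩ cd` and `ac ∩ bd`. -/
def OnDiag (a b c d x : P) : Prop :=
  ∃ X Y, Col L a b X ∧ Col L c d X ∧ Col L a c Y ∧ Col L b d Y ∧ Col L X Y x

variable (L) in
/-- The diagonal points of a quadrangle are collinear. -/
def IsFano (K : Fin 4 → P) : Prop :=
  ∃ Z, Col L (K 0) (K 3) Z ∧ Col L (K 1) (K 2) Z ∧ OnDiag L (K 0) (K 1) (K 2) (K 3) Z

theorem card_mem_sdiff [Fintype P] [Finite L] (l : L) (s : Finset P) (hs : ∀ x ∈ s, x ∈ l) :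
    (#{x | x ∈ l ∧ x ∉ s} : ℤ) = order P L + 1 - #s := by
  have h := card_sdiff_add_card_eq_card (s := s) (t := {x : P | x ∈ l}) fun x hx => by
    simpa using hs x hx
  rw [card_mem] at h
  have h2 : ({x | x ∈ l ∧ x ∉ s} : Finset P) = ({x | x ∈ l} : Finset P) \ s := by
    ext x
    simp
  rw [h2]
  zify at h
  linarith

theorem isArc_snoc_four {K : Fin 4 → P} (hK : IsArc L K) {x : P} :
    IsArc L (Fin.snoc (α := fun _ => P) K x) ↔
      (¬ Col L (K 0) (K 1) x ∧ ¬ Col L (K 0) (K 2) x ∧ ¬ Col L (K 0) (K 3) x) ∧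
        ¬ Col L (K 1) (K 2) x ∧ ¬ Col L (K 1) (K 3) x ∧ ¬ Col L (K 2) (K 3) x := by
  have h : pairs 4 = {(0, 1), (0, 2), (0, 3), (1, 2), (1, 3), (2, 3)} := by decide +kernel
  rw [isArc_snoc, h]
  simp only [mem_insert, mem_singleton, forall_eq_or_imp, forall_eq, hK, true_and, and_assoc,
    and_iff_right_iff_imp]
  rintro ⟨h1, h2, h3, h4, h5, h6⟩ ⟨i, rfl⟩
  fin_cases i
  · exact h1 (col_self_left _ _).swap_right
  · exact h1 (col_self_left _ _).swap_right.swap_left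
  · exact h2 (col_self_left _ _).swap_right.swap_left
  · exact h3 (col_self_left _ _).swap_right.swap_left

variable (L) in
/-- The points `a, b, c, d` form a quadrangle with sides `l₁, …, l₆`. -/
structure Quadrangle (a b c d : P) (ab ac ad bc bd cd : L) : Prop where
  mem_ab : a ∈ ab ∧ b ∈ ab ∧ c ∉ ab ∧ d ∉ ab
  mem_ac : a ∈ ac ∧ c ∈ ac ∧ b ∉ ac ∧ d ∉ ac
  mem_ad : a ∈ ad ∧ d ∈ ad ∧ b ∉ ad ∧ c ∉ ad
  mem_bc : b ∈ bc ∧ c ∈ bc ∧ a ∉ bc ∧ d ∉ bc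
  mem_bd : b ∈ bd ∧ d ∈ bd ∧ a ∉ bd ∧ c ∉ bd
  mem_cd : c ∈ cd ∧ d ∈ cd ∧ a ∉ cd ∧ b ∉ cd

theorem IsArc.exists_side {n : ℕ} {K : Fin n → P} (hK : IsArc L K) {i j k m : Fin n}
    (hij : i ≠ j) (hik : i ≠ k) (hjk : j ≠ k) (him : i ≠ m) (hjm : j ≠ m) :
    ∃ l : L, K i ∈ l ∧ K j ∈ l ∧ K k ∉ l ∧ K m ∉ l := by
  obtain ⟨l, h1, h2⟩ := exists_line_through (L := L) (K i) (K j)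
  exact ⟨l, h1, h2, fun h => hK.2 _ _ _ hij hik hjk ⟨l, h1, h2, h⟩,
    fun h => hK.2 _ _ _ hij him hjm ⟨l, h1, h2, h⟩⟩

theorem IsArc.exists_quadrangle {K : Fin 4 → P} (hK : IsArc L K) :
    ∃ ab ac ad bc bd cd : L, Quadrangle L (K 0) (K 1) (K 2) (K 3) ab ac ad bc bd cd := by
  obtain ⟨ab, h1⟩ := hK.exists_side (i := 0) (j := 1) (k := 2) (m := 3) (by decide) (by decide)
    (by decide) (by decide) (by decide)
  obtain ⟨ac, h2⟩ := hK.exists_side (i := 0) (j := 2) (k := 1) (m := 3) (by decide) (by decide)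
    (by decide) (by decide) (by decide)
  obtain ⟨ad, h3⟩ := hK.exists_side (i := 0) (j := 3) (k := 1) (m := 2) (by decide) (by decide)
    (by decide) (by decide) (by decide)
  obtain ⟨bc, h4⟩ := hK.exists_side (i := 1) (j := 2) (k := 0) (m := 3) (by decide) (by decide)
    (by decide) (by decide) (by decide)
  obtain ⟨bd, h5⟩ := hK.exists_side (i := 1) (j := 3) (k := 0) (m := 2) (by decide) (by decide)
    (by decide) (by decide) (by decide)
  obtain ⟨cd, h6⟩ := hK.exists_side (i := 2) (j := 3) (k := 0) (m := 1) (by decide) (by decide)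
    (by decide) (by decide) (by decide)
  exact ⟨ab, ac, ad, bc, bd, cd, h1, h2, h3, h4, h5, h6⟩

theorem Quadrangle.diag_ne {a b c d X Y : P} {ab ac ad bc bd cd : L}
    (h : Quadrangle L a b c d ab ac ad bc bd cd) (hX : X ∈ ab ∧ X ∈ cd) (hY : Y ∈ ac ∧ Y ∈ bd) :
    X ≠ Y := by
  obtain ⟨h1, h2, -, -, h5, h6⟩ := h
  rintro rfl
  grind [→ eq_or_eq_of_mem]

theorem Quadrangle.vertex_notMem {a b c d X Y : P} {ab ac ad bc bd cd m : L}
    (h : Quadrangle L a b c d ab ac ad bc bd cd) (hX : X ∈ ab ∧ X ∈ cd) (hY : Y ∈ ac ∧ Y ∈ bd)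
    (hm : X ∈ m ∧ Y ∈ m) : a ∉ m ∧ b ∉ m ∧ c ∉ m ∧ d ∉ m := by
  obtain ⟨h1, h2, -, -, h5, h6⟩ := h
  grind [→ eq_or_eq_of_mem]

theorem Quadrangle.onDiag_iff {a b c d X Y : P} {ab ac ad bc bd cd m : L}
    (h : Quadrangle L a b c d ab ac ad bc bd cd) (hX : X ∈ ab ∧ X ∈ cd) (hY : Y ∈ ac ∧ Y ∈ bd)
    (hm : X ∈ m ∧ Y ∈ m) {x : P} : OnDiag L a b c d x ↔ x ∈ m := by
  have hXY := h.diag_ne hX hY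
  obtain ⟨h1, h2, -, -, h5, h6⟩ := h
  have hab : a ≠ b := by rintro rfl; exact h2.2.2.1 h2.1
  have hcd : c ≠ d := by rintro rfl; exact h2.2.2.2 h2.2.1
  have hac : a ≠ c := by rintro rfl; exact h1.2.2.1 h1.1
  have hbd : b ≠ d := by rintro rfl; exact h1.2.2.2 h1.2.1
  constructor
  · rintro ⟨X', Y', i1, i2, i3, i4, i5⟩
    have hX' : X' = X := by
      by_contra hne
      have := eq_of_mem hne (i1.mem hab h1.1 h1.2.1) hX.1 (i2.mem hcd h6.1 h6.2.1) hX.2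
      exact h1.2.2.1 (this ▸ h6.1)
    have hY' : Y' = Y := by
      by_contra hne
      have := eq_of_mem hne (i3.mem hac h2.1 h2.2.1) hY.1 (i4.mem hbd h5.1 h5.2.1) hY.2
      exact h2.2.2.1 (this ▸ h5.1)
    subst hX' hY'
    exact i5.mem hXY hm.1 hm.2
  · intro hx
    exact ⟨X, Y, ⟨ab, h1.1, h1.2.1, hX.1⟩, ⟨cd, h6.1, h6.2.1, hX.2⟩, ⟨ac, h2.1, h2.2.1, hY.1⟩,
      ⟨bd, h5.1, h5.2.1, hY.2⟩, ⟨m, hm.1, hm.2, hx⟩⟩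

variable [Fintype P] [Finite L]

theorem card_onDiag {K : Fin 4 → P} (hK : IsArc L K) :
    (#{x | IsArc L (Fin.snoc (α := fun _ => P) K x) ∧ OnDiag L (K 0) (K 1) (K 2) (K 3) x} : ℤ) =
      order P L - 3 + if IsFano L K then 1 else 0 := by
  obtain ⟨ab, ac, ad, bc, bd, cd, h⟩ := hK.exists_quadrangle
  obtain ⟨X, hX⟩ := exists_point_on ab cd
  obtain ⟨Y, hY⟩ := exists_point_on ac bd
  obtain ⟨m, hm⟩ := exists_line_through (L := L) X Y
  obtain ⟨z, hz⟩ := exists_point_on ad m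
  obtain ⟨w, hw⟩ := exists_point_on bc m
  have hne : ∀ {i j : Fin 4}, i ≠ j → K i ≠ K j := fun h => hK.1.ne h
  have hF : IsFano L K ↔ z = w := by
    unfold IsFano
    simp only [h.onDiag_iff hX hY hm, col_iff_mem (hne (by decide)) h.mem_ad.1 h.mem_ad.2.1,
      col_iff_mem (hne (by decide)) h.mem_bc.1 h.mem_bc.2.1]
    obtain ⟨h1, h2, h3, h4, h5, h6⟩ := h
    constructor
    · rintro ⟨Z, hZ⟩
      grind [→ eq_or_eq_of_mem]
    · rintro rfl
      exact ⟨z, hz.1, hw.1, hz.2⟩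
  have hset : ({x | IsArc L (Fin.snoc (α := fun _ => P) K x) ∧
      OnDiag L (K 0) (K 1) (K 2) (K 3) x} : Finset P) =
      ({x | x ∈ m ∧ x ∉ ({X, Y, z, w} : Finset P)} : Finset P) := by
    refine filter_congr fun x _ => ?_
    simp only [isArc_snoc_four hK, h.onDiag_iff hX hY hm,
      col_iff_mem (hne (by decide)) h.mem_ab.1 h.mem_ab.2.1,
      col_iff_mem (hne (by decide)) h.mem_ac.1 h.mem_ac.2.1,
      col_iff_mem (hne (by decide)) h.mem_ad.1 h.mem_ad.2.1,
      col_iff_mem (hne (by decide)) h.mem_bc.1 h.mem_bc.2.1,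
      col_iff_mem (hne (by decide)) h.mem_bd.1 h.mem_bd.2.1,
      col_iff_mem (hne (by decide)) h.mem_cd.1 h.mem_cd.2.1, mem_insert, mem_singleton]
    obtain ⟨h1, h2, h3, h4, h5, h6⟩ := h
    grind [→ eq_or_eq_of_mem]
  have hXY : X ≠ Y ∧ X ≠ z ∧ X ≠ w ∧ Y ≠ z ∧ Y ≠ w := by
    obtain ⟨h1, h2, h3, h4, h5, h6⟩ := h
    grind [→ eq_or_eq_of_mem]
  rw [hset, card_mem_sdiff, hF]
  · split_ifs with hzw
    · subst hzw
      rw [card_insert_of_notMem (by simp [hXY]), card_insert_of_notMem (by simp [hXY])]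
      simp
      ring
    · rw [card_insert_of_notMem (by simp [hXY]), card_insert_of_notMem (by simp [hXY]),
        card_insert_of_notMem (by simp [hzw])]
      simp
      ring
  · simp [hm, hz, hw]

end Diagonal

section Concurrent

variable {P L : Type*} [Membership P L]

theorem Quadrangle.swap {a b c d : P} {ab ac ad bc bd cd : L}
    (h : Quadrangle L a b c d ab ac ad bc bd cd) : Quadrangle L b a c d ab bc bd ac ad cd := by
  obtain ⟨h1, h2, h3, h4, h5, h6⟩ := h
  constructor <;> tauto

theorem conc_stdMatching_iff {K : Fin 6 → P} : Conc L K (stdMatching 6) ↔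
    ∃ x, Col L (K 0) (K 1) x ∧ Col L (K 2) (K 3) x ∧ Col L (K 4) (K 5) x := by
  simp only [Conc, stdMatching, mem_insert, mem_singleton, forall_eq_or_imp, forall_eq]
  rfl

theorem IsArc.init {n : ℕ} {K : Fin (n + 1) → P} (hK : IsArc L K) :
    IsArc L (Fin.init (α := fun _ => P) K) := by
  rw [← Fin.snoc_init_self K] at hK
  exact (isArc_snoc.1 hK).1

variable [ProjectivePlane P L]

theorem Quadrangle.onDiag_iff_eq {a b c d e X p q : P} {ab ac ad bc bd cd l : L}
    (h : Quadrangle L a b c d ab ac ad bc bd cd) (hX : X ∈ ab ∧ X ∈ cd) (hl : X ∈ l ∧ e ∈ l)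
    (hp : p ∈ ac ∧ p ∈ l) (hq : q ∈ bd ∧ q ∈ l) (he : e ∉ ab ∧ e ∉ ac ∧ e ∉ bd) :
    OnDiag L a b c d e ↔ p = q := by
  obtain ⟨Y, hY⟩ := exists_point_on ac bd
  obtain ⟨m, hm⟩ := exists_line_through (L := L) X Y
  rw [h.onDiag_iff hX hY hm]
  have hXY := h.diag_ne hX hY
  obtain ⟨h1, h2, -, -, h5, h6⟩ := h
  have hXe : X ≠ e := by rintro rfl; exact he.1 hX.1
  have hacl : ac ≠ l := by rintro rfl; exact he.2.1 hl.2
  have hbdl : bd ≠ l := by rintro rfl; exact he.2.2 hl.2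
  have hacbd : ac ≠ bd := by rintro rfl; exact h2.2.2.1 h5.1
  clear h1 h2 h5 h6 hX he
  constructor
  · intro hem
    obtain rfl := eq_of_mem hXe hm.1 hem hl.1 hl.2
    exact ((eq_or_eq_of_mem hp.1 hY.1 hp.2 hm.2).resolve_right hacl).trans
      ((eq_or_eq_of_mem hq.1 hY.2 hq.2 hm.2).resolve_right hbdl).symm
  · rintro rfl
    obtain rfl := (eq_or_eq_of_mem hp.1 hY.1 hq.1 hY.2).resolve_right hacbd
    exact eq_of_mem hXY hl.1 hp.2 hm.1 hm.2 ▸ hl.2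

theorem isArc_snoc_five {K : Fin 5 → P} (hK : IsArc L K) {x : P} :
    IsArc L (Fin.snoc (α := fun _ => P) K x) ↔
      ((¬ Col L (K 0) (K 1) x ∧ ¬ Col L (K 0) (K 2) x ∧ ¬ Col L (K 0) (K 3) x) ∧
        ¬ Col L (K 1) (K 2) x ∧ ¬ Col L (K 1) (K 3) x ∧ ¬ Col L (K 2) (K 3) x) ∧
      ¬ Col L (K 0) (K 4) x ∧ ¬ Col L (K 1) (K 4) x ∧ ¬ Col L (K 2) (K 4) x ∧
        ¬ Col L (K 3) (K 4) x := by
  have h : pairs 5 = {(0, 1), (0, 2), (0, 3), (1, 2), (1, 3), (2, 3), (0, 4), (1, 4), (2, 4),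
    (3, 4)} := by decide +kernel
  rw [isArc_snoc, h]
  simp only [mem_insert, mem_singleton, forall_eq_or_imp, forall_eq, hK, true_and, and_assoc,
    and_iff_right_iff_imp]
  rintro ⟨h1, h2, h3, h4, h5, h6, h7, -⟩ ⟨i, rfl⟩
  fin_cases i
  · exact h1 (col_self_left _ _).swap_right
  · exact h1 (col_self_left _ _).swap_right.swap_left
  · exact h2 (col_self_left _ _).swap_right.swap_left
  · exact h3 (col_self_left _ _).swap_right.swap_left
  · exact h7 (col_self_left _ _).swap_right.swap_left

variable [Fintype P] [Finite L]

theorem card_conc_snoc {K : Fin 5 → P} (hK : IsArc L K) :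
    (#{x | IsArc L (Fin.snoc (α := fun _ => P) K x) ∧
        Conc L (Fin.snoc (α := fun _ => P) K x) (stdMatching 6)} : ℤ) =
      order P L - 5 + (if OnDiag L (K 0) (K 1) (K 2) (K 3) (K 4) then 1 else 0) +
        if OnDiag L (K 1) (K 0) (K 2) (K 3) (K 4) then 1 else 0 := by
  obtain ⟨ab, ac, ad, bc, bd, cd, h⟩ : ∃ ab ac ad bc bd cd : L,
    Quadrangle L (K 0) (K 1) (K 2) (K 3) ab ac ad bc bd cd := hK.init.exists_quadrangle
  obtain ⟨ae, hae⟩ := hK.exists_side (i := 0) (j := 4) (k := 1) (m := 2) (by decide) (by decide)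
    (by decide) (by decide) (by decide)
  obtain ⟨be, hbe⟩ := hK.exists_side (i := 1) (j := 4) (k := 0) (m := 2) (by decide) (by decide)
    (by decide) (by decide) (by decide)
  obtain ⟨ce, hce⟩ := hK.exists_side (i := 2) (j := 4) (k := 0) (m := 3) (by decide) (by decide)
    (by decide) (by decide) (by decide)
  obtain ⟨de, hde⟩ := hK.exists_side (i := 3) (j := 4) (k := 0) (m := 2) (by decide) (by decide)
    (by decide) (by decide) (by decide)
  have hne : ∀ {i j : Fin 5}, i ≠ j → K i ≠ K j := fun h => hK.1.ne h
  have he : ∀ i j, i ≠ j → i ≠ 4 → j ≠ 4 → ∀ l : L, K i ∈ l → K j ∈ l → K 4 ∉ l :=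
    fun i j hij hi hj l h1 h2 h3 => hK.2 i j 4 hij hi hj ⟨l, h1, h2, h3⟩
  have e1 := he 0 1 (by decide) (by decide) (by decide) ab h.mem_ab.1 h.mem_ab.2.1
  have e2 := he 0 2 (by decide) (by decide) (by decide) ac h.mem_ac.1 h.mem_ac.2.1
  have e3 := he 0 3 (by decide) (by decide) (by decide) ad h.mem_ad.1 h.mem_ad.2.1
  have e4 := he 1 2 (by decide) (by decide) (by decide) bc h.mem_bc.1 h.mem_bc.2.1
  have e5 := he 1 3 (by decide) (by decide) (by decide) bd h.mem_bd.1 h.mem_bd.2.1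
  have e6 := he 2 3 (by decide) (by decide) (by decide) cd h.mem_cd.1 h.mem_cd.2.1
  obtain ⟨X, hX⟩ := exists_point_on ab cd
  obtain ⟨l, hl⟩ := exists_line_through (L := L) X (K 4)
  obtain ⟨p₁, hp₁⟩ := exists_point_on ac l
  obtain ⟨p₂, hp₂⟩ := exists_point_on bd l
  obtain ⟨p₃, hp₃⟩ := exists_point_on ad l
  obtain ⟨p₄, hp₄⟩ := exists_point_on bc l
  have d1 : OnDiag L (K 0) (K 1) (K 2) (K 3) (K 4) ↔ p₁ = p₂ :=
    h.onDiag_iff_eq hX hl hp₁ hp₂ ⟨e1, e2, e5⟩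
  have d2 : OnDiag L (K 1) (K 0) (K 2) (K 3) (K 4) ↔ p₃ = p₄ :=
    (h.swap.onDiag_iff_eq hX hl hp₄ hp₃ ⟨e1, e4, e3⟩).trans eq_comm
  have k : ∀ {u : P} {n o : L}, X ∈ n → X ∈ o → u ∉ o → K 4 ∉ n → u ∈ n → u ∉ l := by
    intro u n o h1 h2 h3 h4 h5 h6
    refine h4 (eq_of_mem (a := X) (b := u) ?_ h1 h5 hl.1 h6 ▸ hl.2)
    rintro rfl
    exact h3 h2
  have k0 : K 0 ∉ l := k hX.1 hX.2 h.mem_cd.2.2.1 e1 h.mem_ab.1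
  have k1 : K 1 ∉ l := k hX.1 hX.2 h.mem_cd.2.2.2 e1 h.mem_ab.2.1
  have k2 : K 2 ∉ l := k hX.2 hX.1 h.mem_ab.2.2.1 e6 h.mem_cd.1
  have k3 : K 3 ∉ l := k hX.2 hX.1 h.mem_ab.2.2.2 e6 h.mem_cd.2.1
  have off : ∀ {u p x : P} {n : L}, x ∈ l → x ≠ p → u ∉ l → u ∈ n → p ∈ n → p ∈ l → x ∉ n :=
    fun h1 h2 h3 h4 h5 h6 h7 => h3 (eq_of_mem h2 h7 h5 h1 h6 ▸ h4)
  have hset : ({x | IsArc L (Fin.snoc (α := fun _ => P) K x) ∧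
      Conc L (Fin.snoc (α := fun _ => P) K x) (stdMatching 6)} : Finset P) =
      ({x | x ∈ l ∧ x ∉ ({X, K 4, p₁, p₂, p₃, p₄} : Finset P)} : Finset P) := by
    refine filter_congr fun x _ => ?_
    have hconc : Conc L (Fin.snoc (α := fun _ => P) K x) (stdMatching 6) ↔
        ∃ y, Col L (K 0) (K 1) y ∧ Col L (K 2) (K 3) y ∧ Col L (K 4) x y := conc_stdMatching_iff
    rw [isArc_snoc_five hK, hconc]
    simp only [
      col_iff_mem (hne (by decide)) h.mem_ab.1 h.mem_ab.2.1,
      col_iff_mem (hne (by decide)) h.mem_ac.1 h.mem_ac.2.1,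
      col_iff_mem (hne (by decide)) h.mem_ad.1 h.mem_ad.2.1,
      col_iff_mem (hne (by decide)) h.mem_bc.1 h.mem_bc.2.1,
      col_iff_mem (hne (by decide)) h.mem_bd.1 h.mem_bd.2.1,
      col_iff_mem (hne (by decide)) h.mem_cd.1 h.mem_cd.2.1,
      col_iff_mem (hne (by decide)) hae.1 hae.2.1, col_iff_mem (hne (by decide)) hbe.1 hbe.2.1,
      col_iff_mem (hne (by decide)) hce.1 hce.2.1, col_iff_mem (hne (by decide)) hde.1 hde.2.1,
      mem_insert, mem_singleton]
    constructor
    · rintro ⟨⟨⟨⟨x1, x2, x3⟩, x4, x5, x6⟩, x7, -⟩, y, hy1, hy2, n, hn⟩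
      have hy : y = X := (eq_or_eq_of_mem hy1 hX.1 hy2 hX.2).resolve_right
        fun h' => h.mem_cd.2.2.1 (h' ▸ h.mem_ab.1)
      subst hy
      have hny : K 4 ≠ y := by rintro h'; exact e1 (h' ▸ hy1)
      obtain rfl := eq_of_mem hny hn.1 hn.2.2 hl.2 hl.1
      refine ⟨hn.2.1, ?_⟩
      rintro (rfl | rfl | rfl | rfl | rfl | rfl)
      exacts [x1 hy1, x7 hae.2.1, x2 hp₁.1, x5 hp₂.1, x3 hp₃.1, x4 hp₄.1]
    · rintro ⟨hx, hx'⟩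
      simp only [not_or] at hx'
      obtain ⟨x1, x2, x3, x4, x5, x6⟩ := hx'
      exact ⟨⟨⟨⟨off hx x1 k0 h.mem_ab.1 hX.1 hl.1, off hx x3 k0 h.mem_ac.1 hp₁.1 hp₁.2,
        off hx x5 k0 h.mem_ad.1 hp₃.1 hp₃.2⟩, off hx x6 k1 h.mem_bc.1 hp₄.1 hp₄.2,
        off hx x4 k1 h.mem_bd.1 hp₂.1 hp₂.2, off hx x1 k2 h.mem_cd.1 hX.2 hl.1⟩,
        off hx x2 k0 hae.1 hae.2.1 hl.2, off hx x2 k1 hbe.1 hbe.2.1 hl.2,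
        off hx x2 k2 hce.1 hce.2.1 hl.2, off hx x2 k3 hde.1 hde.2.1 hl.2⟩,
        X, hX.1, hX.2, l, hl.2, hx, hl.1⟩
  have hs : ∀ x ∈ ({X, K 4, p₁, p₂, p₃, p₄} : Finset P), x ∈ l := by
    simp [hl, hp₁, hp₂, hp₃, hp₄]
  have ne : ∀ {x y z : P} {n o : L}, x ∈ l → z ∈ n → z ∈ o → z ∉ l → x ∈ n → y ∈ o →
      n ≠ o → x ≠ y := by
    rintro x y z n o h1 h2 h3 h4 h5 h6 hno rfl
    exact hno (eq_of_mem (a := x) (b := z) (by rintro rfl; exact h4 h1) h5 h2 h6 h3)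
  have hX' : X ∉ ({K 4, p₁, p₂, p₃, p₄} : Finset P) := by
    simp only [mem_insert, mem_singleton]
    rintro (h' | h' | h' | h' | h')
    · exact e1 (h' ▸ hX.1)
    · exact ne hl.1 h.mem_ab.1 h.mem_ac.1 k0 hX.1 hp₁.1
        (fun h'' => h.mem_ac.2.2.1 (h'' ▸ h.mem_ab.2.1)) h'
    · exact ne hl.1 h.mem_ab.2.1 h.mem_bd.1 k1 hX.1 hp₂.1
        (fun h'' => h.mem_bd.2.2.1 (h'' ▸ h.mem_ab.1)) h'
    · exact ne hl.1 h.mem_ab.1 h.mem_ad.1 k0 hX.1 hp₃.1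
        (fun h'' => h.mem_ad.2.2.1 (h'' ▸ h.mem_ab.2.1)) h'
    · exact ne hl.1 h.mem_ab.2.1 h.mem_bc.1 k1 hX.1 hp₄.1
        (fun h'' => h.mem_bc.2.2.1 (h'' ▸ h.mem_ab.1)) h'
  have he' : K 4 ∉ ({p₁, p₂, p₃, p₄} : Finset P) := by
    simp only [mem_insert, mem_singleton]
    rintro (h' | h' | h' | h')
    exacts [e2 (h' ▸ hp₁.1), e5 (h' ▸ hp₂.1), e3 (h' ▸ hp₃.1), e4 (h' ▸ hp₄.1)]
  have h12 : p₁ ∉ ({p₃, p₄} : Finset P) ∧ p₂ ∉ ({p₃, p₄} : Finset P) := by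
    simp only [mem_insert, mem_singleton, not_or]
    exact ⟨⟨ne hp₁.2 h.mem_ac.1 h.mem_ad.1 k0 hp₁.1 hp₃.1
        (fun h'' => h.mem_ad.2.2.2 (h'' ▸ h.mem_ac.2.1)),
      ne hp₁.2 h.mem_ac.2.1 h.mem_bc.2.1 k2 hp₁.1 hp₄.1
        (fun h'' => h.mem_bc.2.2.1 (h'' ▸ h.mem_ac.1))⟩,
      ne hp₂.2 h.mem_bd.2.1 h.mem_ad.2.1 k3 hp₂.1 hp₃.1
        (fun h'' => h.mem_ad.2.2.1 (h'' ▸ h.mem_bd.1)),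
      ne hp₂.2 h.mem_bd.1 h.mem_bc.1 k1 hp₂.1 hp₄.1
        (fun h'' => h.mem_bc.2.2.2 (h'' ▸ h.mem_bd.2.1))⟩
  have hpair : ∀ a b : P, (#{a, b} : ℤ) = 2 - if a = b then 1 else 0 := by
    intro a b
    split_ifs with hab
    · simp [hab]
    · simp [card_pair hab]
  have hc : #({p₁, p₂, p₃, p₄} : Finset P) = #{p₁, p₂} + #{p₃, p₄} := by
    rw [← card_union_of_disjoint]
    · rw [insert_union, singleton_union]
    · rw [disjoint_left]
      intro x hx
      rw [mem_insert, mem_singleton] at hx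
      rcases hx with rfl | rfl
      exacts [h12.1, h12.2]
  rw [hset, card_mem_sdiff _ _ hs, d1, d2, card_insert_of_notMem hX', card_insert_of_notMem he',
    hc]
  push_cast
  rw [hpair, hpair]
  ring

end Concurrent

section SixArcs

variable {P L : Type*} [Membership P L] [ProjectivePlane P L]

theorem onDiag_iff_of_conc {K : Fin 6 → P} (hK : IsArc L K) :
    Conc L K (stdMatching 6) ∧ Conc L K (meetingMatching 1) ↔
      OnDiag L (K 0) (K 1) (K 2) (K 3) (K 4) ∧ OnDiag L (K 0) (K 1) (K 2) (K 3) (K 5) := by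
  have h1 : Conc L K (meetingMatching 1) ↔
      ∃ x, Col L (K 0) (K 2) x ∧ Col L (K 1) (K 3) x ∧ Col L (K 4) (K 5) x := by
    simp only [Conc, meetingMatching, mem_insert, mem_singleton, forall_eq_or_imp, forall_eq]
  obtain ⟨ab, ac, ad, bc, bd, cd, h⟩ : ∃ ab ac ad bc bd cd : L,
    Quadrangle L (K 0) (K 1) (K 2) (K 3) ab ac ad bc bd cd := hK.init.init.exists_quadrangle
  have hne : ∀ {i j : Fin 6}, i ≠ j → K i ≠ K j := fun h => hK.1.ne h
  obtain ⟨X, hX⟩ := exists_point_on ab cd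
  obtain ⟨Y, hY⟩ := exists_point_on ac bd
  obtain ⟨m, hm⟩ := exists_line_through (L := L) X Y
  obtain ⟨l, hl⟩ := exists_line_through (L := L) (K 4) (K 5)
  have hXY : X ≠ Y := h.diag_ne hX hY
  rw [conc_stdMatching_iff, h1, h.onDiag_iff hX hY hm, h.onDiag_iff hX hY hm]
  simp only [col_iff_mem (hne (by decide)) h.mem_ab.1 h.mem_ab.2.1,
    col_iff_mem (hne (by decide)) h.mem_ac.1 h.mem_ac.2.1,
    col_iff_mem (hne (by decide)) h.mem_bd.1 h.mem_bd.2.1,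
    col_iff_mem (hne (by decide)) h.mem_cd.1 h.mem_cd.2.1,
    col_iff_mem (hne (by decide)) hl.1 hl.2]
  constructor
  · rintro ⟨⟨X', hX'⟩, Y', hY'⟩
    obtain rfl : X' = X := (eq_or_eq_of_mem hX'.1 hX.1 hX'.2.1 hX.2).resolve_right
      fun h' => h.mem_cd.2.2.1 (h' ▸ h.mem_ab.1)
    obtain rfl : Y' = Y := (eq_or_eq_of_mem hY'.1 hY.1 hY'.2.1 hY.2).resolve_right
      fun h' => h.mem_bd.2.2.1 (h' ▸ h.mem_ac.1)
    obtain rfl := eq_of_mem hXY hX'.2.2 hY'.2.2 hm.1 hm.2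
    exact hl
  · rintro ⟨h4, h5⟩
    obtain rfl := eq_of_mem (hne (by decide)) hl.1 hl.2 h4 h5
    exact ⟨⟨X, hX.1, hX.2, hm.1⟩, Y, hY.1, hY.2, hm.2⟩

variable [Fintype P] [Finite L]

theorem card_isArc_onDiag (Q : (Fin 4 → P) → Prop) :
    (#{K : Fin 5 → P | IsArc L K ∧ OnDiag L (K 0) (K 1) (K 2) (K 3) (K 4) ∧
        Q (Fin.init (α := fun _ => P) K)} : ℤ) =
      #{K : Fin 4 → P | IsArc L K ∧ Q K} * ((order P L : ℤ) - 3) +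
        #{K : Fin 4 → P | IsArc L K ∧ IsFano L K ∧ Q K} := by
  have h (K : Fin 4 → P) : (#{x | IsArc L (Fin.snoc (α := fun _ => P) K x) ∧
        OnDiag L (K 0) (K 1) (K 2) (K 3) x ∧
        Q (Fin.init (α := fun _ => P) (Fin.snoc (α := fun _ => P) K x))} : ℤ) =
      (if IsArc L K ∧ Q K then (order P L : ℤ) - 3 else 0) +
        if IsArc L K ∧ IsFano L K ∧ Q K then 1 else 0 := by
    by_cases hK : IsArc L K ∧ Q K
    · simp only [Fin.init_snoc, hK, and_true, true_and, if_true]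
      exact card_onDiag hK.1
    · rw [if_neg hK, if_neg (by tauto), add_zero, Nat.cast_eq_zero, card_eq_zero,
        filter_eq_empty_iff]
      rintro x - ⟨hx, -, hQ⟩
      exact hK ⟨(isArc_snoc.1 hx).1, by simpa using hQ⟩
  rw [card_filter_snoc, Nat.cast_sum]
  refine (sum_congr rfl fun K _ => h K).trans ?_
  rw [sum_add_distrib, ← sum_filter, sum_const, nsmul_eq_mul, sum_boole]

theorem card_conc_six :
    (#{K : Fin 6 → P | IsArc L K ∧ Conc L K (stdMatching 6)} : ℤ) =
      numArcs P L 4 * (((order P L : ℤ) - 2) * (order P L - 3) * (order P L - 5) +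
        2 * (order P L - 3)) + 2 * #{K : Fin 4 → P | IsArc L K ∧ IsFano L K} := by
  have h (K : Fin 5 → P) : (#{x | IsArc L (Fin.snoc (α := fun _ => P) K x) ∧
        Conc L (Fin.snoc (α := fun _ => P) K x) (stdMatching 6)} : ℤ) =
      (if IsArc L K then (order P L : ℤ) - 5 else 0) +
        (if IsArc L K ∧ OnDiag L (K 0) (K 1) (K 2) (K 3) (K 4) then 1 else 0) +
        if IsArc L K ∧ OnDiag L (K 1) (K 0) (K 2) (K 3) (K 4) then 1 else 0 := by
    by_cases hK : IsArc L K
    · simp only [hK, true_and, if_true]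
      exact card_conc_snoc hK
    · simp [hK, isArc_snoc]
  have hswap : #{K : Fin 5 → P | IsArc L K ∧ OnDiag L (K 1) (K 0) (K 2) (K 3) (K 4)} =
      #{K : Fin 5 → P | IsArc L K ∧ OnDiag L (K 0) (K 1) (K 2) (K 3) (K 4)} := by
    rw [← card_filter_comp (Equiv.swap 0 1)
      fun K : Fin 5 → P => IsArc L K ∧ OnDiag L (K 0) (K 1) (K 2) (K 3) (K 4)]
    congr 1
    ext K
    simp only [mem_filter, mem_univ, true_and, isArc_comp]
    rfl
  have hE := card_isArc_onDiag (P := P) (L := L) fun _ => True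
  simp only [and_true] at hE
  have h5 := numArcs_five (P := P) (L := L)
  rw [card_filter_snoc, Nat.cast_sum]
  refine (sum_congr rfl fun K _ => h K).trans ?_
  rw [sum_add_distrib, sum_add_distrib, ← sum_filter, sum_const, nsmul_eq_mul, sum_boole, sum_boole,
    hswap, hE]
  unfold numArcs at h5 ⊢
  rw [h5]
  ring

theorem card_conc_meeting_one :
    (#{K : Fin 6 → P | IsArc L K ∧ Conc L K (stdMatching 6) ∧ Conc L K (meetingMatching 1)} : ℤ) =
      numArcs P L 4 * (((order P L : ℤ) - 3) * (order P L - 4)) +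
        2 * ((order P L : ℤ) - 3) * #{K : Fin 4 → P | IsArc L K ∧ IsFano L K} := by
  have key (K : Fin 5 → P) (hK : IsArc L K) (hD : OnDiag L (K 0) (K 1) (K 2) (K 3) (K 4)) (x : P) :
      IsArc L (Fin.snoc (α := fun _ => P) K x) ∧ OnDiag L (K 0) (K 1) (K 2) (K 3) x ↔
        (IsArc L (Fin.snoc (α := fun _ => P) (Fin.init (α := fun _ => P) K) x) ∧
          OnDiag L (K 0) (K 1) (K 2) (K 3) x) ∧ x ≠ K 4 := by
    obtain ⟨ab, ac, ad, bc, bd, cd, h⟩ : ∃ ab ac ad bc bd cd : L,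
      Quadrangle L (K 0) (K 1) (K 2) (K 3) ab ac ad bc bd cd := hK.init.exists_quadrangle
    obtain ⟨X, hX⟩ := exists_point_on ab cd
    obtain ⟨Y, hY⟩ := exists_point_on ac bd
    obtain ⟨m, hm⟩ := exists_line_through (L := L) X Y
    have hmem := h.vertex_notMem hX hY hm
    rw [isArc_snoc_five hK, isArc_snoc_four hK.init]
    rw [h.onDiag_iff hX hY hm] at hD
    have hoff : ∀ {u : P}, u ∉ m → x ∈ m → (¬ Col L u (K 4) x ↔ x ≠ K 4) := by
      intro u hu hx
      refine not_congr ⟨fun hc => ?_, ?_⟩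
      · by_contra hne
        exact hu (hc.swap_right.swap_left.swap_right.mem hne hx hD)
      · rintro rfl
        exact (col_self_left _ _).swap_right.swap_left.swap_right
    rw [h.onDiag_iff hX hY hm]
    by_cases hx : x ∈ m
    · rw [hoff hmem.1 hx, hoff hmem.2.1 hx, hoff hmem.2.2.1 hx, hoff hmem.2.2.2 hx]
      simp only [Fin.init]
      simp only [hx, and_true, and_self]
      rfl
    · simp [hx]
  have h (K : Fin 5 → P) : (#{x | IsArc L (Fin.snoc (α := fun _ => P) K x) ∧
      OnDiag L (K 0) (K 1) (K 2) (K 3) (K 4) ∧ OnDiag L (K 0) (K 1) (K 2) (K 3) x} : ℤ) =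
      (if IsArc L K ∧ OnDiag L (K 0) (K 1) (K 2) (K 3) (K 4) then (order P L : ℤ) - 4 else 0) +
        if IsArc L K ∧ OnDiag L (K 0) (K 1) (K 2) (K 3) (K 4) ∧
          IsFano L (Fin.init (α := fun _ => P) K) then 1 else 0 := by
    by_cases hK : IsArc L K ∧ OnDiag L (K 0) (K 1) (K 2) (K 3) (K 4)
    · simp only [hK, true_and, if_true, key K hK.1 hK.2]
      have h4 : K 4 ∈ ({x | IsArc L (Fin.snoc (α := fun _ => P) (Fin.init (α := fun _ => P) K) x) ∧
          OnDiag L (K 0) (K 1) (K 2) (K 3) x} : Finset P) := by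
        rw [mem_filter]
        refine ⟨mem_univ _, ?_, hK.2⟩
        have := Fin.snoc_init_self K
        exact this.symm ▸ hK.1
      have hc := card_onDiag hK.1.init
      have he : ({x | (IsArc L (Fin.snoc (α := fun _ => P) (Fin.init (α := fun _ => P) K) x) ∧
          OnDiag L (K 0) (K 1) (K 2) (K 3) x) ∧ x ≠ K 4} : Finset P) =
          ({x | IsArc L (Fin.snoc (α := fun _ => P) (Fin.init (α := fun _ => P) K) x) ∧
          OnDiag L (K 0) (K 1) (K 2) (K 3) x} : Finset P).erase (K 4) := by
        ext x
        simp only [mem_filter, mem_univ, true_and, mem_erase, and_comm]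
      rw [he, card_erase_of_mem h4, Nat.cast_pred (card_pos.2 ⟨_, h4⟩)]
      exact (congrArg (· - 1) hc).trans (by ring)
    · rw [if_neg hK, if_neg (by tauto), add_zero, Nat.cast_eq_zero, card_eq_zero,
        filter_eq_empty_iff]
      rintro x - ⟨hx, hQ, -⟩
      exact hK ⟨(isArc_snoc.1 hx).1, hQ⟩
  have hE := card_isArc_onDiag (P := P) (L := L) fun _ => True
  have hE' := card_isArc_onDiag (P := P) (L := L) fun K => IsFano L K
  simp only [and_true, and_self] at hE hE'
  have hset : ({K : Fin 6 → P | IsArc L K ∧ Conc L K (stdMatching 6) ∧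
      Conc L K (meetingMatching 1)} : Finset (Fin 6 → P)) = ({K : Fin 6 → P | IsArc L K ∧
        OnDiag L (K 0) (K 1) (K 2) (K 3) (K 4) ∧ OnDiag L (K 0) (K 1) (K 2) (K 3) (K 5)} :
      Finset (Fin 6 → P)) :=
    filter_congr fun K _ => and_congr_right fun hK => onDiag_iff_of_conc hK
  rw [hset, card_filter_snoc, Nat.cast_sum]
  refine (sum_congr rfl fun K _ => h K).trans ?_
  rw [sum_add_distrib, ← sum_filter, sum_const, nsmul_eq_mul, sum_boole, hE, hE']
  unfold numArcs
  ring

end SixArcs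

section Grid

variable {P L : Type*} [Membership P L]

/-- Three lines `r i` through `X` and three lines `s i` through `Y`, none of them joining
`X` and `Y`. -/
structure Frame (X Y : P) (r s : Fin 3 → L) : Prop where
  inj_left : Function.Injective r
  inj_right : Function.Injective s
  mem_left : ∀ i, X ∈ r i ∧ Y ∉ r i
  mem_right : ∀ i, Y ∈ s i ∧ X ∉ s i

theorem Frame.symm {X Y : P} {r s : Fin 3 → L} (h : Frame X Y r s) : Frame Y X s r :=
  ⟨h.2, h.1, h.4, h.3⟩

/-- The rows of the six cells of a hexagon in a `3 × 3` grid. -/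
def row : Fin 6 → Fin 3 := ![0, 0, 1, 1, 2, 2]

/-- The columns of the six cells of a hexagon in a `3 × 3` grid. -/
def column : Fin 6 → Fin 3 := ![0, 1, 1, 2, 2, 0]

variable (L) in
/-- The hexagon `a` has its sides alternately passing through `X` and `Y`. -/
def Hexagon (X Y : P) (a : Fin 6 → P) : Prop :=
  ∃ r s : Fin 3 → L, Frame X Y r s ∧ ∀ i, a i ∈ r (row i) ∧ a i ∈ s (column i)

theorem Hexagon.rotate {X Y : P} {a : Fin 6 → P} (h : Hexagon L X Y a) :
    Hexagon L Y X fun i => a (i + 1) := by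
  obtain ⟨r, s, h, ha⟩ := h
  refine ⟨fun i => s (i + 1), r, ⟨h.inj_right.comp (add_left_injective _), h.inj_left,
    fun i => h.mem_right _, h.mem_left⟩, fun i => ?_⟩
  have key : ∀ i, row i + 1 = column (i + 1) ∧ column i = row (i + 1) := by decide
  beta_reduce
  rw [(key i).1, (key i).2]
  exact (ha _).symm

theorem card_hexagon_col_odd [Fintype P] :
    #{g : P × P × (Fin 6 → P) | Hexagon L g.1 g.2.1 g.2.2 ∧
      Col L (g.2.2 1) (g.2.2 3) (g.2.2 5)} =
    #{g : P × P × (Fin 6 → P) | Hexagon L g.1 g.2.1 g.2.2 ∧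
      Col L (g.2.2 0) (g.2.2 2) (g.2.2 4)} := by
  have hr : ∀ (a : Fin 6 → P), (fun i => a (i + 1 - 1)) = a ∧ (fun i => a (i - 1 + 1)) = a :=
    fun a => ⟨funext fun i => by simp, funext fun i => by simp⟩
  have hback {X Y : P} {a : Fin 6 → P} (h : Hexagon L X Y a) :
      Hexagon L Y X fun i => a (i - 1) := by
    have := h.rotate.rotate.rotate.rotate.rotate
    convert this using 3
    rename_i i
    revert i
    decide
  refine card_nbij' (fun g => (g.2.1, g.1, fun i => g.2.2 (i + 1)))
    (fun g => (g.2.1, g.1, fun i => g.2.2 (i - 1))) ?_ ?_ ?_ ?_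
  · intro g hg
    simp only [coe_filter, mem_univ, true_and, Set.mem_ofPred_eq] at hg ⊢
    exact ⟨hg.1.rotate, hg.2⟩
  · intro g hg
    simp only [coe_filter, mem_univ, true_and, Set.mem_ofPred_eq] at hg ⊢
    exact ⟨hback hg.1, hg.2⟩
  · intro g _
    simp
  · intro g _
    simp

variable [ProjectivePlane P L]

theorem Frame.mem_left_iff {X Y u : P} {r s : Fin 3 → L} (h : Frame X Y r s) {i j k : Fin 3}
    (hu : u ∈ r i ∧ u ∈ s j) : u ∈ r k ↔ k = i := by
  refine ⟨fun hk => h.inj_left ?_, fun hk => hk ▸ hu.1⟩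
  refine (eq_or_eq_of_mem hk (h.mem_left k).1 hu.1 (h.mem_left i).1).resolve_left ?_
  rintro rfl
  exact (h.mem_right j).2 hu.2

theorem Frame.eq_of_mem {X Y u v : P} {r s : Fin 3 → L} (h : Frame X Y r s) {i j : Fin 3}
    (hu : u ∈ r i ∧ u ∈ s j) (hv : v ∈ r i ∧ v ∈ s j) : u = v :=
  (eq_or_eq_of_mem hu.1 hv.1 hu.2 hv.2).resolve_right fun h' =>
    (h.mem_left i).2 (h' ▸ (h.mem_right j).1)

theorem Frame.not_col_left {X Y u v w : P} {r s : Fin 3 → L} (h : Frame X Y r s)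
    {i j j' k k' : Fin 3} (hu : u ∈ r i ∧ u ∈ s j) (hv : v ∈ r i ∧ v ∈ s j')
    (hw : w ∈ r k ∧ w ∈ s k') (hj : j ≠ j') (hk : i ≠ k) : ¬ Col L u v w := by
  intro hc
  refine hk ((h.mem_left_iff hw).1 (hc.mem ?_ hu.1 hv.1))
  rintro rfl
  exact hj ((h.symm.mem_left_iff hv.symm).1 hu.2)

theorem Frame.not_col {X Y : P} {r s : Fin 3 → L} {a : Fin 6 → P} (h : Frame X Y r s)
    (ha : ∀ i, a i ∈ r (row i) ∧ a i ∈ s (column i)) {i j k : Fin 6}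
    (hijk : row i = row j ∧ column i ≠ column j ∧ row i ≠ row k ∨
      column i = column j ∧ row i ≠ row j ∧ column i ≠ column k) :
    ¬ Col L (a i) (a j) (a k) := by
  rcases hijk with ⟨h1, h2, h3⟩ | ⟨h1, h2, h3⟩
  · exact h.not_col_left (ha i) (h1 ▸ ha j) (ha k) h2 h3
  · exact h.symm.not_col_left (ha i).symm (h1 ▸ (ha j).symm) (ha k).symm h2 h3

theorem Hexagon.isArc_iff {X Y : P} {a : Fin 6 → P} (h : Hexagon L X Y a) :
    IsArc L a ↔ ¬ Col L (a 0) (a 2) (a 4) ∧ ¬ Col L (a 1) (a 3) (a 5) := by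
  obtain ⟨r, s, h, ha⟩ := h
  refine ⟨fun h => ⟨h.2 _ _ _ (by decide) (by decide) (by decide),
    h.2 _ _ _ (by decide) (by decide) (by decide)⟩, fun hT => isArc_of_lt (by norm_num) ?_⟩
  have key : ∀ i j k : Fin 6, i < j → j < k → (i = 0 ∧ j = 2 ∧ k = 4) ∨ (i = 1 ∧ j = 3 ∧ k = 5) ∨
    (row i = row j ∧ column i ≠ column j ∧ row i ≠ row k ∨
      column i = column j ∧ row i ≠ row j ∧ column i ≠ column k) ∨
    (row i = row k ∧ column i ≠ column k ∧ row i ≠ row j ∨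
      column i = column k ∧ row i ≠ row k ∧ column i ≠ column j) ∨
    (row j = row k ∧ column j ≠ column k ∧ row j ≠ row i ∨
      column j = column k ∧ row j ≠ row k ∧ column j ≠ column i) := by decide +kernel
  intro i j k hij hjk
  rcases key i j k hij hjk with ⟨rfl, rfl, rfl⟩ | ⟨rfl, rfl, rfl⟩ | h' | h' | h'
  · exact hT.1
  · exact hT.2
  · exact h.not_col ha h'
  · exact fun hc => h.not_col ha h' hc.swap_right
  · exact fun hc => h.not_col ha h' hc.swap_left.swap_right

theorem Hexagon.eq {X Y X' Y' : P} {a : Fin 6 → P} (h : Hexagon L X Y a)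
    (h' : Hexagon L X' Y' a) : X = X' := by
  obtain ⟨r, s, h, ha⟩ := h
  obtain ⟨r', s', h', ha'⟩ := h'
  have hr : ∀ i j, i ≠ j → row i = row j → column i ≠ column j → r (row i) = r' (row i) := by
    intro i j hij h1 h2
    refine eq_of_mem (a := a i) (b := a j) ?_ (ha i).1 (h1 ▸ (ha j).1) (ha' i).1 (h1 ▸ (ha' j).1)
    intro he
    exact h2 ((h.symm.mem_left_iff (ha j).symm).1 (he ▸ (ha i).2))
  have h0 : r 0 = r' 0 := hr 0 1 (by decide) (by decide) (by decide)
  have h1 : r 1 = r' 1 := hr 2 3 (by decide) (by decide) (by decide)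
  refine (eq_or_eq_of_mem (h.mem_left 0).1 (h0 ▸ (h'.mem_left 0).1) (h.mem_left 1).1
    (h1 ▸ (h'.mem_left 1).1)).resolve_right fun h2 => ?_
  exact absurd (h.inj_left h2) (by decide)

theorem IsArc.exists_hexagon_iff {K : Fin 6 → P} (hK : IsArc L K) :
    (∃ X Y, Hexagon L X Y K) ↔ Conc L K (stdMatching 6) ∧ Conc L K (meetingMatching 0) := by
  have h1 : Conc L K (meetingMatching 0) ↔
      ∃ x, Col L (K 1) (K 2) x ∧ Col L (K 3) (K 4) x ∧ Col L (K 5) (K 0) x := by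
    simp only [Conc, meetingMatching, mem_insert, mem_singleton, forall_eq_or_imp, forall_eq]
  rw [conc_stdMatching_iff, h1]
  constructor
  · rintro ⟨X, Y, r, s, h, ha⟩
    exact ⟨⟨X, ⟨r 0, (ha 0).1, (ha 1).1, (h.mem_left 0).1⟩, ⟨r 1, (ha 2).1, (ha 3).1,
      (h.mem_left 1).1⟩, ⟨r 2, (ha 4).1, (ha 5).1, (h.mem_left 2).1⟩⟩,
      Y, ⟨s 1, (ha 1).2, (ha 2).2, (h.mem_right 1).1⟩, ⟨s 2, (ha 3).2, (ha 4).2,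
      (h.mem_right 2).1⟩, ⟨s 0, (ha 5).2, (ha 0).2, (h.mem_right 0).1⟩⟩
  · rintro ⟨⟨X, ⟨r₀, i0, i1, x0⟩, ⟨r₁, i2, i3, x1⟩, ⟨r₂, i4, i5, x2⟩⟩,
      Y, ⟨s₁, j1, j2, y1⟩, ⟨s₂, j3, j4, y2⟩, ⟨s₀, j5, j0, y0⟩⟩
    have off : ∀ (i j k : Fin 6) (l : L), i ≠ j → i ≠ k → j ≠ k → K i ∈ l → K j ∈ l → K k ∉ l :=
      fun i j k l hij hik hjk h1 h2 h3 => hK.2 i j k hij hik hjk ⟨l, h1, h2, h3⟩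
    have key : ∀ (Z : P) (i j k m n : Fin 6) (l l' l'' : L), i ≠ j → j ≠ k → i ≠ k → m ≠ n →
        m ≠ j → n ≠ j → K i ∈ l → K j ∈ l → K j ∈ l' → K k ∈ l' → K m ∈ l'' → K n ∈ l'' →
        Z ∈ l' → Z ∈ l'' → Z ∉ l := by
      intro Z i j k m n l l' l'' hij hjk hik hmn hmj hnj h1 h2 h3 h4 h5 h6 h7 h8 h9
      rcases eq_or_eq_of_mem h2 h9 h3 h7 with rfl | rfl
      · exact off m n j l'' hmn hmj hnj h5 h6 h8
      · exact off i j k l hij hik hjk h1 h2 h4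
    have inj : ∀ l m n : L, l ≠ m → l ≠ n → m ≠ n → Function.Injective ![l, m, n] := by
      intro l m n h1 h2 h3 i j
      fin_cases i <;> fin_cases j <;> simp [h1, h2, h3, h1.symm, h2.symm, h3.symm]
    have ne : ∀ (i j k : Fin 6) (l m : L), i ≠ j → i ≠ k → j ≠ k → K i ∈ l → K j ∈ l → K k ∈ m →
        l ≠ m := fun i j k l m hij hik hjk h1 h2 h3 h4 => off i j k l hij hik hjk h1 h2 (h4 ▸ h3)
    refine ⟨X, Y, ![r₀, r₁, r₂], ![s₀, s₁, s₂],
      ⟨inj _ _ _ ?_ ?_ ?_, inj _ _ _ ?_ ?_ ?_, ?_, ?_⟩, ?_⟩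
    · exact ne 0 1 2 _ _ (by decide) (by decide) (by decide) i0 i1 i2
    · exact ne 0 1 4 _ _ (by decide) (by decide) (by decide) i0 i1 i4
    · exact ne 2 3 4 _ _ (by decide) (by decide) (by decide) i2 i3 i4
    · exact ne 5 0 1 _ _ (by decide) (by decide) (by decide) j5 j0 j1
    · exact ne 5 0 3 _ _ (by decide) (by decide) (by decide) j5 j0 j3
    · exact ne 1 2 3 _ _ (by decide) (by decide) (by decide) j1 j2 j3
    · intro i
      fin_cases i
      · exact ⟨x0, key Y 0 1 2 3 4 _ _ _ (by decide) (by decide) (by decide) (by decide)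
          (by decide) (by decide) i0 i1 j1 j2 j3 j4 y1 y2⟩
      · exact ⟨x1, key Y 3 2 1 5 0 _ _ _ (by decide) (by decide) (by decide) (by decide)
          (by decide) (by decide) i3 i2 j2 j1 j5 j0 y1 y0⟩
      · exact ⟨x2, key Y 4 5 0 1 2 _ _ _ (by decide) (by decide) (by decide) (by decide)
          (by decide) (by decide) i4 i5 j5 j0 j1 j2 y0 y1⟩
    · intro i
      fin_cases i
      · exact ⟨y0, key X 5 0 1 2 3 _ _ _ (by decide) (by decide) (by decide) (by decide)
          (by decide) (by decide) j5 j0 i0 i1 i2 i3 x0 x1⟩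
      · exact ⟨y1, key X 1 2 3 4 5 _ _ _ (by decide) (by decide) (by decide) (by decide)
          (by decide) (by decide) j1 j2 i2 i3 i4 i5 x1 x2⟩
      · exact ⟨y2, key X 3 4 5 0 1 _ _ _ (by decide) (by decide) (by decide) (by decide)
          (by decide) (by decide) j3 j4 i4 i5 i0 i1 x2 x0⟩
    · intro i
      fin_cases i <;> simp [row, column, *]

theorem card_filter_eq_add {α : Type*} [Fintype α] (A B C : α → Prop) [DecidablePred A]
    [DecidablePred B] [DecidablePred C] (h : ∀ x, A x ↔ B x ∨ C x) (hd : ∀ x, B x → ¬ C x) :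
    #{x | A x} = #{x | B x} + #{x | C x} := by
  rw [← card_union_of_disjoint]
  · congr 1
    ext x
    simp [h]
  · exact disjoint_filter.2 fun x _ => hd x

/-- The three points `b` are on the diagonal of a grid with centres `X` and `Y`. -/
def Transversal (L : Type*) [Membership P L] (X Y : P) (b : Fin 3 → P) : Prop :=
  ∃ r s : Fin 3 → L, Frame X Y r s ∧ ∀ i, b i ∈ r i ∧ b i ∈ s i

theorem transversal_iff {X Y a b c : P} : Transversal L X Y ![a, b, c] ↔
    (¬ Col L X Y a ∧ ¬ Col L X Y b ∧ ¬ Col L X a b ∧ ¬ Col L Y a b) ∧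
      ¬ Col L X Y c ∧ ¬ Col L X a c ∧ ¬ Col L X b c ∧ ¬ Col L Y a c ∧ ¬ Col L Y b c := by
  have h : Transversal L X Y ![a, b, c] ↔ ∀ i, ¬ Col L X Y (![a, b, c] i) ∧
      ∀ j, i < j → ¬ Col L X (![a, b, c] i) (![a, b, c] j) ∧
        ¬ Col L Y (![a, b, c] i) (![a, b, c] j) := by
    generalize ![a, b, c] = t
    constructor
    · rintro ⟨r, s, h, ht⟩ i
      have hX : X ≠ t i := fun he => (h.mem_right i).2 (he ▸ (ht i).2)
      have hY : Y ≠ t i := fun he => (h.mem_left i).2 (he ▸ (ht i).1)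
      refine ⟨fun hc => (h.mem_left i).2 (hc.swap_right.mem hX (h.mem_left i).1 (ht i).1),
        fun j hij => ⟨fun hc => hij.ne ?_, fun hc => hij.ne ?_⟩⟩
      · exact (h.mem_left_iff (ht j)).1 (hc.mem hX (h.mem_left i).1 (ht i).1)
      · exact (h.symm.mem_left_iff (ht j).symm).1 (hc.mem hY (h.mem_right i).1 (ht i).2)
    · intro h
      choose r hr using fun i => exists_line_through (L := L) X (t i)
      choose s hs using fun i => exists_line_through (L := L) Y (t i)
      have inj : ∀ (Z : P) (u : Fin 3 → L), (∀ i, Z ∈ u i ∧ t i ∈ u i) →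
          (∀ i j, i < j → ¬ Col L Z (t i) (t j)) → Function.Injective u := by
        intro Z u hu hZ i j hij
        rcases lt_trichotomy i j with h' | h' | h'
        · exact absurd ⟨u i, (hu i).1, (hu i).2, hij ▸ (hu j).2⟩ (hZ i j h')
        · exact h'
        · exact absurd ⟨u j, (hu j).1, (hu j).2, hij ▸ (hu i).2⟩ (hZ j i h')
      exact ⟨r, s, ⟨inj X r hr fun i j hij => ((h i).2 j hij).1,
        inj Y s hs fun i j hij => ((h i).2 j hij).2,
        fun i => ⟨(hr i).1, fun hY => (h i).1 ⟨r i, (hr i).1, hY, (hr i).2⟩⟩,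
        fun i => ⟨(hs i).1, fun hX => (h i).1 ⟨s i, hX, (hs i).1, (hs i).2⟩⟩⟩,
        fun i => ⟨(hr i).2, (hs i).2⟩⟩
  rw [h]
  simp only [Fin.forall_fin_succ, Fin.isValue, Matrix.cons_val]
  simp
  tauto

theorem isArc_four_iff {K : Fin 4 → P} : IsArc L K ↔ ¬ Col L (K 0) (K 1) (K 2) ∧
    ¬ Col L (K 0) (K 1) (K 3) ∧ ¬ Col L (K 0) (K 2) (K 3) ∧ ¬ Col L (K 1) (K 2) (K 3) := by
  refine ⟨fun h => ⟨h.2 _ _ _ (by decide) (by decide) (by decide),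
    h.2 _ _ _ (by decide) (by decide) (by decide), h.2 _ _ _ (by decide) (by decide) (by decide),
    h.2 _ _ _ (by decide) (by decide) (by decide)⟩, fun h => isArc_of_lt (by norm_num) ?_⟩
  have key : ∀ i j k : Fin 4, i < j → j < k → (i = 0 ∧ j = 1 ∧ k = 2) ∨
    (i = 0 ∧ j = 1 ∧ k = 3) ∨ (i = 0 ∧ j = 2 ∧ k = 3) ∨ (i = 1 ∧ j = 2 ∧ k = 3) := by decide
  intro i j k hij hjk
  rcases key i j k hij hjk with ⟨rfl, rfl, rfl⟩ | ⟨rfl, rfl, rfl⟩ | ⟨rfl, rfl, rfl⟩ |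
    ⟨rfl, rfl, rfl⟩
  exacts [h.1, h.2.1, h.2.2.1, h.2.2.2]

variable [Fintype P]

theorem card_hexagon (Q : (Fin 3 → P) → Prop) [DecidablePred Q] :
    #{g : P × P × (Fin 6 → P) | Hexagon L g.1 g.2.1 g.2.2 ∧ Q ![g.2.2 0, g.2.2 2, g.2.2 4]} =
      #{b : Fin 5 → P | Transversal L (b 0) (b 1) ![b 2, b 3, b 4] ∧ Q ![b 2, b 3, b 4]} := by
  have diag : ∀ g : Fin 6 → P, ∀ i : Fin 3,
      g (![0, 2, 4] i) = ![g 0, g 2, g 4] i := by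
    intro g i
    fin_cases i <;> rfl
  have key : ∀ i : Fin 3, row (![0, 2, 4] i) = i ∧ column (![0, 2, 4] i) = i := by decide
  refine card_bij (fun g _ => ![g.1, g.2.1, g.2.2 0, g.2.2 2, g.2.2 4]) ?_ ?_ ?_
  · rintro ⟨X, Y, a⟩ hg
    simp only [mem_filter, mem_univ, true_and] at hg ⊢
    obtain ⟨⟨r, s, h, ha⟩, hQ⟩ := hg
    refine ⟨⟨r, s, h, fun i => ?_⟩, hQ⟩
    have := ha (![0, 2, 4] i)
    rw [(key i).1, (key i).2, diag a i] at this
    exact this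
  · rintro ⟨X, Y, a⟩ hg ⟨X', Y', a'⟩ hg' heq
    simp only [mem_filter, mem_univ, true_and] at hg hg'
    obtain ⟨⟨r, s, h, ha⟩, -⟩ := hg
    obtain ⟨⟨r', s', h', ha'⟩, -⟩ := hg'
    obtain rfl : X = X' := congrFun heq 0
    obtain rfl : Y = Y' := congrFun heq 1
    have hd : ∀ i, a (![0, 2, 4] i) = a' (![0, 2, 4] i) := by
      intro i
      fin_cases i
      exacts [congrFun heq 2, congrFun heq 3, congrFun heq 4]
    have ha1 : ∀ i, a (![0, 2, 4] i) ∈ r i ∧ a (![0, 2, 4] i) ∈ s i := fun i => by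
      have := ha (![0, 2, 4] i)
      rwa [(key i).1, (key i).2] at this
    have ha2 : ∀ i, a (![0, 2, 4] i) ∈ r' i ∧ a (![0, 2, 4] i) ∈ s' i := fun i => by
      have := ha' (![0, 2, 4] i)
      rwa [(key i).1, (key i).2, ← hd] at this
    have hr : r = r' := funext fun i => by
      refine eq_of_mem ?_ (h.mem_left i).1 (ha1 i).1 (h'.mem_left i).1 (ha2 i).1
      rintro he
      exact (h.mem_right i).2 (he ▸ (ha1 i).2)
    have hs : s = s' := funext fun i => by
      refine eq_of_mem ?_ (h.mem_right i).1 (ha1 i).2 (h'.mem_right i).1 (ha2 i).2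
      rintro he
      exact (h.mem_left i).2 (he ▸ (ha1 i).1)
    subst hr hs
    have : a = a' := funext fun i => h.eq_of_mem (ha i) (ha' i)
    rw [this]
  · intro b hb
    simp only [mem_filter, mem_univ, true_and] at hb
    obtain ⟨⟨r, s, h, hb⟩, hQ⟩ := hb
    choose a ha using fun i => exists_point_on (r (row i)) (s (column i))
    have h0 : a 0 = b 2 := h.eq_of_mem (ha 0) (hb 0)
    have h2 : a 2 = b 3 := h.eq_of_mem (ha 2) (hb 1)
    have h4 : a 4 = b 4 := h.eq_of_mem (ha 4) (hb 2)
    refine ⟨(b 0, b 1, a), ?_, ?_⟩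
    · simp only [mem_filter, mem_univ, true_and, h0, h2, h4]
      exact ⟨⟨r, s, h, ha⟩, hQ⟩
    · simp only [h0, h2, h4]
      ext i
      fin_cases i <;> rfl

theorem card_hexagon_not_col :
    (#{g : P × P × (Fin 6 → P) | Hexagon L g.1 g.2.1 g.2.2 ∧
      ¬ Col L (g.2.2 0) (g.2.2 2) (g.2.2 4)} : ℤ) = numArcs P L 5 := by
  refine congrArg Nat.cast ((card_hexagon (L := L) fun b => ¬ Col L (b 0) (b 1) (b 2)).trans ?_)
  refine congrArg card (filter_congr fun b _ => ?_)
  have h : IsArc L b ↔ IsArc L (Fin.init (α := fun _ => P) b) ∧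
      IsArc L (Fin.snoc (α := fun _ => P) (Fin.init (α := fun _ => P) b) (b 4)) := by
    have := Fin.snoc_init_self b
    exact ⟨fun hb => ⟨hb.init, this.symm ▸ hb⟩, fun hb => this ▸ hb.2⟩
  have h4 : IsArc L (Fin.init (α := fun _ => P) b) ↔ ¬ Col L (b 0) (b 1) (b 2) ∧
    ¬ Col L (b 0) (b 1) (b 3) ∧ ¬ Col L (b 0) (b 2) (b 3) ∧ ¬ Col L (b 1) (b 2) (b 3) :=
    isArc_four_iff
  have h5 (hb : IsArc L (Fin.init (α := fun _ => P) b)) :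
      IsArc L (Fin.snoc (α := fun _ => P) (Fin.init (α := fun _ => P) b) (b 4)) ↔
      (¬ Col L (b 0) (b 1) (b 4) ∧ ¬ Col L (b 0) (b 2) (b 4) ∧ ¬ Col L (b 0) (b 3) (b 4)) ∧
        ¬ Col L (b 1) (b 2) (b 4) ∧ ¬ Col L (b 1) (b 3) (b 4) ∧ ¬ Col L (b 2) (b 3) (b 4) :=
    isArc_snoc_four hb
  rw [transversal_iff, h, and_congr_right h5, h4]
  change _ ∧ ¬ Col L (b 2) (b 3) (b 4) ↔ _
  clear h h4 h5
  tauto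

variable [Finite L]

theorem card_hexagon_col :
    (#{g : P × P × (Fin 6 → P) | Hexagon L g.1 g.2.1 g.2.2 ∧
      Col L (g.2.2 0) (g.2.2 2) (g.2.2 4)} : ℤ) = numArcs P L 4 * (order P L - 2) := by
  have h (K : Fin 4 → P) : (#{x | Transversal L (K 0) (K 1) ![K 2, K 3, x] ∧
      Col L (K 2) (K 3) x} : ℤ) = if IsArc L K then (order P L : ℤ) - 2 else 0 := by
    split_ifs with hK
    · obtain ⟨ab, ac, ad, bc, bd, cd, h⟩ := hK.exists_quadrangle
      obtain ⟨z, hz⟩ := exists_point_on ab cd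
      have hne : ∀ {i j : Fin 4}, i ≠ j → K i ≠ K j := fun h => hK.1.ne h
      have hset : ({x | Transversal L (K 0) (K 1) ![K 2, K 3, x] ∧
          Col L (K 2) (K 3) x} : Finset P) =
          ({x | x ∈ cd ∧ x ∉ ({K 2, K 3, z} : Finset P)} : Finset P) := by
        refine filter_congr fun x _ => ?_
        simp only [transversal_iff, isArc_four_iff.1 hK,
          col_iff_mem (hne (by decide)) h.mem_ab.1 h.mem_ab.2.1,
          col_iff_mem (hne (by decide)) h.mem_ac.1 h.mem_ac.2.1,
          col_iff_mem (hne (by decide)) h.mem_ad.1 h.mem_ad.2.1,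
          col_iff_mem (hne (by decide)) h.mem_bc.1 h.mem_bc.2.1,
          col_iff_mem (hne (by decide)) h.mem_bd.1 h.mem_bd.2.1,
          col_iff_mem (hne (by decide)) h.mem_cd.1 h.mem_cd.2.1, mem_insert, mem_singleton]
        obtain ⟨h1, h2, h3, h4, h5, h6⟩ := h
        grind [→ eq_or_eq_of_mem]
      rw [hset, card_mem_sdiff, card_insert_of_notMem, card_insert_of_notMem]
      · simp
        ring
      · rintro he
        exact h.mem_ab.2.2.2 (mem_singleton.1 he ▸ hz.1)
      · simp only [mem_insert, mem_singleton, not_or]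
        exact ⟨hne (by decide), fun he => h.mem_ab.2.2.1 (he ▸ hz.1)⟩
      · simp [h.mem_cd, hz]
    · rw [Nat.cast_eq_zero, card_eq_zero, filter_eq_empty_iff]
      rintro x - ⟨hx, -⟩
      rw [transversal_iff] at hx
      exact hK (isArc_four_iff.2 hx.1)
  refine (congrArg Nat.cast (card_hexagon (L := L) fun b => Col L (b 0) (b 1) (b 2))).trans ?_
  rw [card_filter_snoc, Nat.cast_sum]
  refine (sum_congr rfl fun K _ => h K).trans ?_
  rw [← sum_filter, sum_const, nsmul_eq_mul]
  rfl

theorem card_conc_meeting_zero :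
    (#{K : Fin 6 → P | IsArc L K ∧ Conc L K (stdMatching 6) ∧ Conc L K (meetingMatching 0)} : ℤ) =
      numArcs P L 4 * (((order P L : ℤ) - 2) * (order P L - 4)) +
        #{g : P × P × (Fin 6 → P) | Hexagon L g.1 g.2.1 g.2.2 ∧
          Col L (g.2.2 0) (g.2.2 2) (g.2.2 4) ∧ Col L (g.2.2 1) (g.2.2 3) (g.2.2 5)} := by
  have h1 : #{K : Fin 6 → P | IsArc L K ∧ Conc L K (stdMatching 6) ∧
      Conc L K (meetingMatching 0)} = #{g : P × P × (Fin 6 → P) | Hexagon L g.1 g.2.1 g.2.2 ∧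
        ¬ Col L (g.2.2 0) (g.2.2 2) (g.2.2 4) ∧ ¬ Col L (g.2.2 1) (g.2.2 3) (g.2.2 5)} := by
    symm
    refine card_bij (fun g _ => g.2.2) ?_ ?_ ?_
    · rintro ⟨X, Y, a⟩ hg
      simp only [mem_filter, mem_univ, true_and] at hg ⊢
      have := hg.1.isArc_iff.2 hg.2
      exact ⟨this, this.exists_hexagon_iff.1 ⟨X, Y, hg.1⟩⟩
    · rintro ⟨X, Y, a⟩ hg ⟨X', Y', a'⟩ hg' heq
      simp only [mem_filter, mem_univ, true_and] at hg hg' heq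
      subst heq
      rw [hg.1.eq hg'.1, hg.1.rotate.eq hg'.1.rotate]
    · intro K hK
      simp only [mem_filter, mem_univ, true_and] at hK
      obtain ⟨X, Y, h⟩ := hK.1.exists_hexagon_iff.2 hK.2
      refine ⟨(X, Y, K), ?_, rfl⟩
      simp only [mem_filter, mem_univ, true_and]
      exact ⟨h, h.isArc_iff.1 hK.1⟩
  have h2 : numArcs P L 5 = #{g : P × P × (Fin 6 → P) | Hexagon L g.1 g.2.1 g.2.2 ∧
        ¬ Col L (g.2.2 0) (g.2.2 2) (g.2.2 4) ∧ ¬ Col L (g.2.2 1) (g.2.2 3) (g.2.2 5)} +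
      #{g : P × P × (Fin 6 → P) | Hexagon L g.1 g.2.1 g.2.2 ∧
        ¬ Col L (g.2.2 0) (g.2.2 2) (g.2.2 4) ∧ Col L (g.2.2 1) (g.2.2 3) (g.2.2 5)} := by
    rw [← card_hexagon_not_col]
    exact_mod_cast card_filter_eq_add _ _ _ (by tauto) (by tauto)
  have h3 : numArcs P L 4 * (order P L - 2) = #{g : P × P × (Fin 6 → P) |
        Hexagon L g.1 g.2.1 g.2.2 ∧
        Col L (g.2.2 0) (g.2.2 2) (g.2.2 4) ∧ Col L (g.2.2 1) (g.2.2 3) (g.2.2 5)} +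
      #{g : P × P × (Fin 6 → P) | Hexagon L g.1 g.2.1 g.2.2 ∧
        ¬ Col L (g.2.2 0) (g.2.2 2) (g.2.2 4) ∧ Col L (g.2.2 1) (g.2.2 3) (g.2.2 5)} := by
    rw [← card_hexagon_col, ← card_hexagon_col_odd]
    exact_mod_cast card_filter_eq_add _ _ _ (by tauto) (by tauto)
  rw [numArcs_five] at h2
  rw [h1]
  linear_combination h3 - h2

end Grid

section Realization

variable {P L : Type*} [Membership P L] [ProjectivePlane P L]

/-- The lines of the cyclic configuration on `ZMod n`. -/
def block {n : ℕ} (a : ZMod n) : Finset (ZMod n) := {a, a + 1, a + 3}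

variable (L) in
/-- The points `p` are distinct, and three of them are collinear precisely when their labels form
a block. -/
def Realizes {n : ℕ} (p : ZMod n → P) : Prop :=
  Function.Injective p ∧ ∀ i j k, i ≠ j → i ≠ k → j ≠ k →
    (Col L (p i) (p j) (p k) ↔ ∃ a : ZMod n, {i, j, k} = block a)

theorem realizes_iff {n : ℕ} (hn : n = 7 ∨ n = 8) {p : ZMod n → P} :
    Realizes L p ↔ ∃ l : ZMod n → L, ∀ a k, p k ∈ l a ↔ k ∈ block a := by
  have h1 : ∀ a : ZMod n, a ≠ a + 1 ∧ a ≠ a + 3 ∧ a + 1 ≠ a + 3 := by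
    rcases hn with rfl | rfl <;> decide +kernel
  have h2 : ∀ a b k : ZMod n, k ≠ a → k ≠ a + 1 → {a, a + 1, k} = block b → k ∈ block a := by
    rcases hn with rfl | rfl <;> decide +kernel
  have h3 : ∀ i j : ZMod n, i ≠ j → ∃ a, i ∈ block a ∧ j ∉ block a := by
    rcases hn with rfl | rfl <;> decide +kernel
  have h4 : ∀ i j k : ZMod n, i ≠ j → i ≠ k → j ≠ k → (∃ a, {i, j, k} = block a) ∨
      (∃ a, i ∈ block a ∧ j ∈ block a ∧ k ∉ block a) ∨
        (∃ a, i ∈ block a ∧ k ∈ block a ∧ j ∉ block a) ∨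
        ∃ a, j ∈ block a ∧ k ∈ block a ∧ i ∉ block a := by
    rcases hn with rfl | rfl <;> decide +kernel
  constructor
  · rintro ⟨hp, h⟩
    choose l hl using fun a : ZMod n =>
      (h a (a + 1) (a + 3) (h1 a).1 (h1 a).2.1 (h1 a).2.2).2 ⟨a, rfl⟩
    refine ⟨l, fun a k => ⟨fun hk => ?_, fun hk => ?_⟩⟩
    · by_cases hka : k = a
      · simp [block, hka]
      by_cases hka' : k = a + 1
      · simp [block, hka']
      obtain ⟨b, hb⟩ := (h a (a + 1) k (h1 a).1 (Ne.symm hka) (Ne.symm hka')).1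
        ⟨l a, (hl a).1, (hl a).2.1, hk⟩
      exact h2 a b k hka hka' hb
    · simp only [block, mem_insert, mem_singleton] at hk
      rcases hk with rfl | rfl | rfl
      exacts [(hl _).1, (hl _).2.1, (hl _).2.2]
  · rintro ⟨l, h⟩
    have hp : Function.Injective p := by
      intro i j hij
      by_contra hne
      obtain ⟨a, hi, hj⟩ := h3 i j hne
      exact hj ((h a j).1 (hij ▸ (h a i).2 hi))
    refine ⟨hp, fun i j k hij hik hjk => ⟨fun hc => ?_, ?_⟩⟩
    · refine (h4 i j k hij hik hjk).resolve_right ?_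
      rintro (⟨a, hi, hj, hk⟩ | ⟨a, hi, hk, hj⟩ | ⟨a, hj, hk, hi⟩)
      · exact hk ((h a k).1 (hc.mem (hp.ne hij) ((h a i).2 hi) ((h a j).2 hj)))
      · exact hj ((h a j).1 (hc.swap_right.mem (hp.ne hik) ((h a i).2 hi) ((h a k).2 hk)))
      · exact hi ((h a i).1
          (hc.swap_left.swap_right.mem (hp.ne hjk) ((h a j).2 hj) ((h a k).2 hk)))
    · rintro ⟨a, ha⟩
      exact ⟨l a, (h a i).2 (by simp [← ha]), (h a j).2 (by simp [← ha]),
        (h a k).2 (by simp [← ha])⟩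

/-- The map `f` sends blocks to blocks. -/
def PreservesBlocks {n : ℕ} (f : ZMod n → ZMod n) : Prop :=
  ∀ a, ∃ b, ({f a, f (a + 1), f (a + 3)} : Finset (ZMod n)) = block b

instance {n : ℕ} [NeZero n] (f : ZMod n → ZMod n) : Decidable (PreservesBlocks f) :=
  inferInstanceAs (Decidable (∀ _, ∃ _, _))

theorem Realizes.comp_iff {n : ℕ} (hn : n = 7 ∨ n = 8) {p : ZMod n → P} (h : Realizes L p)
    (σ : Equiv.Perm (ZMod n)) : Realizes L (p ∘ σ) ↔ PreservesBlocks σ := by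
  have h1 : ∀ a : ZMod n, a ≠ a + 1 ∧ a ≠ a + 3 ∧ a + 1 ≠ a + 3 := by
    rcases hn with rfl | rfl <;> decide +kernel
  constructor
  · intro h' a
    exact (h.2 _ _ _ (σ.injective.ne (h1 a).1) (σ.injective.ne (h1 a).2.1)
      (σ.injective.ne (h1 a).2.2)).1 ((h'.2 _ _ _ (h1 a).1 (h1 a).2.1 (h1 a).2.2).2 ⟨a, rfl⟩)
  · intro hσ
    choose b hb using hσ
    obtain ⟨l, hl⟩ := (realizes_iff hn).1 h
    refine (realizes_iff hn).2 ⟨fun a => l (b a), fun a k => ?_⟩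
    rw [Function.comp_apply, hl, ← hb]
    simp [block]

theorem card_exists_realizes [Fintype P] {n : ℕ} [NeZero n] (hn : n = 7 ∨ n = 8) :
    #{p : ZMod n → P | ∃ σ : Equiv.Perm (ZMod n), Realizes L (p ∘ σ)} *
        #{σ : Equiv.Perm (ZMod n) | PreservesBlocks σ} =
      n.factorial * #{p : ZMod n → P | Realizes L p} := by
  have h1 (p : ZMod n → P) : #{σ : Equiv.Perm (ZMod n) | Realizes L (p ∘ σ)} =
      if ∃ σ : Equiv.Perm (ZMod n), Realizes L (p ∘ σ) then
        #{σ : Equiv.Perm (ZMod n) | PreservesBlocks σ} else 0 := by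
    split_ifs with h
    · obtain ⟨τ, hτ⟩ := h
      refine (card_equiv (Equiv.mulLeft τ) fun σ => ?_).symm
      simp only [mem_filter, mem_univ, true_and, ← hτ.comp_iff hn]
      rfl
    · rw [card_eq_zero, filter_eq_empty_iff]
      exact fun σ _ hσ => h ⟨σ, hσ⟩
  have h2 (σ : Equiv.Perm (ZMod n)) : #{p : ZMod n → P | Realizes L (p ∘ σ)} =
      #{p : ZMod n → P | Realizes L p} := by
    refine card_equiv (σ.symm.arrowCongr (Equiv.refl P)) fun p => ?_
    simp only [mem_filter, mem_univ, true_and]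
    rfl
  have h3 := sum_card_bipartiteAbove_eq_sum_card_bipartiteBelow (s := univ) (t := univ)
    fun (p : ZMod n → P) (σ : Equiv.Perm (ZMod n)) => Realizes L (p ∘ σ)
  simp only [bipartiteAbove, bipartiteBelow] at h3
  rw [sum_congr rfl fun p _ => h1 p, sum_congr rfl fun σ _ => h2 σ] at h3
  rw [← sum_filter, sum_const, sum_const, card_univ, Fintype.card_perm, ZMod.card] at h3
  simpa using h3

/-- The third point of the block through `i` and `j`. -/
def third {n : ℕ} (i j : ZMod n) : ZMod n :=
  if j = i + 1 then i + 3 else if j = i - 1 then i + 2 else if j = i + 3 then i + 1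
    else if j = i - 3 then i - 2 else if j = i + 2 then i - 1 else i - 3

/-- The map determined by three initial values and the requirement that blocks be preserved. -/
def extend {n : ℕ} (t : ZMod n × ZMod n × ZMod n) (m : ZMod n) : ZMod n :=
  ((fun t : ZMod n × ZMod n × ZMod n => (t.2.1, t.2.2, third t.1 t.2.1))^[m.val] t).1

theorem PreservesBlocks.extend_eq {n : ℕ} (hn : n = 7 ∨ n = 8) {σ : Equiv.Perm (ZMod n)}
    (h : PreservesBlocks σ) : extend (σ 0, σ 1, σ 2) = σ := by
  have h1 : ∀ a : ZMod n, a ≠ a + 1 ∧ a ≠ a + 3 ∧ a + 1 ≠ a + 3 := by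
    rcases hn with rfl | rfl <;> decide +kernel
  have h2 : ∀ i j k b : ZMod n, i ≠ j → i ≠ k → j ≠ k → {i, j, k} = block b → third i j = k := by
    rcases hn with rfl | rfl <;> decide +kernel
  have : NeZero n := ⟨by omega⟩
  have key (m : ℕ) : (fun t : ZMod n × ZMod n × ZMod n => (t.2.1, t.2.2, third t.1 t.2.1))^[m]
      (σ 0, σ 1, σ 2) = (σ m, σ (m + 1), σ (m + 2)) := by
    induction m with
    | zero => simp
    | succ m ih =>
      rw [Function.iterate_succ_apply', ih]
      obtain ⟨b, hb⟩ := h m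
      rw [h2 _ _ _ b (σ.injective.ne (h1 m).1) (σ.injective.ne (h1 m).2.1)
        (σ.injective.ne (h1 m).2.2) hb]
      push_cast
      ring_nf
  funext m
  rw [extend, key, ZMod.natCast_zmod_val]

theorem card_preservesBlocks {n : ℕ} [NeZero n] (hn : n = 7 ∨ n = 8) :
    #{σ : Equiv.Perm (ZMod n) | PreservesBlocks σ} =
      #{t : ZMod n × ZMod n × ZMod n | Function.Injective (extend t) ∧
        PreservesBlocks (extend t) ∧ t = (extend t 0, extend t 1, extend t 2)} := by
  refine card_bij (fun σ _ => (σ 0, σ 1, σ 2)) ?_ ?_ ?_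
  · intro σ hσ
    simp only [mem_filter, mem_univ, true_and] at hσ ⊢
    rw [hσ.extend_eq hn]
    exact ⟨σ.injective, hσ, rfl⟩
  · intro σ hσ τ hτ h
    simp only [mem_filter, mem_univ, true_and] at hσ hτ
    exact DFunLike.coe_injective ((hσ.extend_eq hn).symm.trans (h ▸ hτ.extend_eq hn))
  · intro t ht
    simp only [mem_filter, mem_univ, true_and] at ht
    refine ⟨Equiv.ofBijective _ (Finite.injective_iff_bijective.1 ht.1), ?_, ht.2.2.symm⟩
    simpa using ht.2.1

theorem card_preservesBlocks_seven :
    #{σ : Equiv.Perm (ZMod 7) | PreservesBlocks σ} = 168 := by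
  rw [card_preservesBlocks (.inl rfl)]
  decide +kernel

theorem card_preservesBlocks_eight :
    #{σ : Equiv.Perm (ZMod 8) | PreservesBlocks σ} = 48 := by
  rw [card_preservesBlocks (.inr rfl)]
  decide +kernel

end Realization

section Count

variable {P L : Type*} [Membership P L]

theorem Realizes.col {n : ℕ} {p : ZMod n → P} (h : Realizes L p) (i j k : ZMod n)
    (hij : i ≠ j ∧ i ≠ k ∧ j ≠ k) (hb : ∃ a : ZMod n, {i, j, k} = block a) :
    Col L (p i) (p j) (p k) :=
  (h.2 i j k hij.1 hij.2.1 hij.2.2).2 hb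

theorem Realizes.not_col {n : ℕ} {p : ZMod n → P} (h : Realizes L p) (i j k : ZMod n)
    (hij : i ≠ j ∧ i ≠ k ∧ j ≠ k) (hb : ¬ ∃ a : ZMod n, {i, j, k} = block a) :
    ¬ Col L (p i) (p j) (p k) :=
  fun hc => hb ((h.2 i j k hij.1 hij.2.1 hij.2.2).1 hc)

variable [ProjectivePlane P L]

theorem IsArc.exists_realizes {K : Fin 4 → P} (hK : IsArc L K) (hF : IsFano L K) :
    ∃ X Y Z : P, Realizes (n := 7) L ![Z, X, K 0, Y, K 1, K 2, K 3] := by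
  obtain ⟨ab, ac, ad, bc, bd, cd, h⟩ := hK.exists_quadrangle
  obtain ⟨X, hX⟩ := exists_point_on ab cd
  obtain ⟨Y, hY⟩ := exists_point_on ac bd
  obtain ⟨m, hm⟩ := exists_line_through (L := L) X Y
  obtain ⟨Z, hZ⟩ := hF
  have hne : ∀ {i j : Fin 4}, i ≠ j → K i ≠ K j := fun h => hK.1.ne h
  rw [h.onDiag_iff hX hY hm, col_iff_mem (hne (by decide)) h.mem_ad.1 h.mem_ad.2.1,
    col_iff_mem (hne (by decide)) h.mem_bc.1 h.mem_bc.2.1] at hZ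
  have hv := h.vertex_notMem hX hY hm
  have hX' : X ∉ ac ∧ X ∉ ad ∧ X ∉ bc ∧ X ∉ bd := by
    obtain ⟨h1, h2, h3, h4, h5, h6⟩ := h
    grind [→ eq_or_eq_of_mem]
  have hY' : Y ∉ ab ∧ Y ∉ ad ∧ Y ∉ bc ∧ Y ∉ cd := by
    obtain ⟨h1, h2, h3, h4, h5, h6⟩ := h
    grind [→ eq_or_eq_of_mem]
  have hZ' : Z ∉ ab ∧ Z ∉ ac ∧ Z ∉ bd ∧ Z ∉ cd := by
    obtain ⟨h1, h2, h3, h4, h5, h6⟩ := h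
    grind [→ eq_or_eq_of_mem]
  refine ⟨X, Y, Z, (realizes_iff (.inl rfl)).2 ⟨![m, ab, ac, bd, bc, cd, ad], fun a k => ?_⟩⟩
  obtain ⟨h1, h2, h3, h4, h5, h6⟩ := h
  change Fin 7 at a k
  change ![Z, X, K 0, Y, K 1, K 2, K 3] k ∈ ![m, ab, ac, bd, bc, cd, ad] a ↔
    k ∈ ({a, a + 1, a + 3} : Finset (Fin 7))
  fin_cases a <;> fin_cases k <;> simp [*]

theorem Hexagon.realizes {X Y : P} {a : Fin 6 → P} (h : Hexagon L X Y a)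
    (h₁ : Col L (a 0) (a 2) (a 4)) (h₂ : Col L (a 1) (a 3) (a 5)) :
    Realizes (n := 8) L ![X, a 0, a 5, a 1, Y, a 3, a 2, a 4] := by
  obtain ⟨r, s, h, ha⟩ := h
  obtain ⟨t, ht⟩ := h₁
  obtain ⟨u, hu⟩ := h₂
  have hr : ∀ i k, a i ∈ r k ↔ k = row i := fun i k => h.mem_left_iff (ha i)
  have hs : ∀ i k, a i ∈ s k ↔ k = column i := fun i k => h.symm.mem_left_iff (ha i).symm
  have off : ∀ i j (v : L), row i ≠ row j → a i ∈ v → a j ∈ v → ∀ x, x ∈ r (row i) →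
      x ≠ a i → x ∉ v := by
    intro i j v hij hi hj x hx hne hxv
    exact hij ((hr _ _).1 (eq_of_mem hne hx (ha i).1 hxv hi ▸ hj))
  have hY : ∀ i j (v : L), column i ≠ column j → a i ∈ v → a j ∈ v → Y ∉ v := by
    intro i j v hij hi hj hYv
    have hne : Y ≠ a i := fun hi => (h.mem_left (row i)).2 (hi ▸ (ha i).1)
    exact hij ((hs _ _).1 (eq_of_mem hne (h.mem_right _).1 (ha i).2 hYv hi ▸ hj))
  have hX : ∀ i, X ≠ a i := fun i hi => (h.mem_right (column i)).2 (hi ▸ (ha i).2)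
  have hne : ∀ i j, column i ≠ column j → a i ≠ a j := fun i j hij he =>
    hij ((hs j _).1 (he ▸ (ha i).2))
  have hXt := off 0 2 t (by decide) ht.1 ht.2.1 X (h.mem_left _).1 (hX 0)
  have hXu := off 1 3 u (by decide) hu.1 hu.2.1 X (h.mem_left _).1 (hX 1)
  have hYt := hY 0 2 t (by decide) ht.1 ht.2.1
  have hYu := hY 1 3 u (by decide) hu.1 hu.2.1
  have h1 := off 0 2 t (by decide) ht.1 ht.2.1 (a 1) (ha 1).1 (hne 1 0 (by decide))
  have h3 := off 2 4 t (by decide) ht.2.1 ht.2.2 (a 3) (ha 3).1 (hne 3 2 (by decide))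
  have h5 := off 4 0 t (by decide) ht.2.2 ht.1 (a 5) (ha 5).1 (hne 5 4 (by decide))
  have h0 := off 1 3 u (by decide) hu.1 hu.2.1 (a 0) (ha 0).1 (hne 0 1 (by decide))
  have h2 := off 3 5 u (by decide) hu.2.1 hu.2.2 (a 2) (ha 2).1 (hne 2 3 (by decide))
  have h4 := off 5 1 u (by decide) hu.2.2 hu.1 (a 4) (ha 4).1 (hne 4 5 (by decide))
  have hXY := fun k => And.intro (h.mem_left k) (h.mem_right k)
  refine (realizes_iff (.inr rfl)).2 ⟨![r 0, s 0, u, s 1, s 2, r 1, t, r 2], fun b k => ?_⟩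
  change Fin 8 at b k
  change ![X, a 0, a 5, a 1, Y, a 3, a 2, a 4] k ∈ ![r 0, s 0, u, s 1, s 2, r 1, t, r 2] b ↔
    k ∈ ({b, b + 1, b + 3} : Finset (Fin 8))
  clear off hY hX hne
  fin_cases b <;> fin_cases k <;> simp [row, column, *]

theorem Realizes.hexagon {p : ZMod 8 → P} (h : Realizes L p) :
    Hexagon L (p 0) (p 4) ![p 1, p 3, p 6, p 5, p 7, p 2] := by
  obtain ⟨l, hl⟩ := (realizes_iff (.inr rfl)).1 h
  have inj : ∀ f : Fin 3 → ZMod 8, (∀ i j, i ≠ j → ∃ k, k ∈ block (f i) ∧ k ∉ block (f j)) →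
      Function.Injective fun i => l (f i) := by
    intro f hf i j hij
    by_contra hne
    obtain ⟨k, hi, hj⟩ := hf i j hne
    have hij : l (f i) = l (f j) := hij
    exact hj ((hl _ _).1 (hij ▸ (hl _ _).2 hi))
  have h1 : ∀ i : Fin 3, (0 : ZMod 8) ∈ block (![0, 5, 7] i : ZMod 8) ∧
    (4 : ZMod 8) ∉ block (![0, 5, 7] i : ZMod 8) ∧ (4 : ZMod 8) ∈ block (![1, 3, 4] i : ZMod 8) ∧
    (0 : ZMod 8) ∉ block (![1, 3, 4] i : ZMod 8) := by decide +kernel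
  have h2 : ∀ i : Fin 6, (![1, 3, 6, 5, 7, 2] i : ZMod 8) ∈ block (![0, 5, 7] (row i) : ZMod 8) ∧
    (![1, 3, 6, 5, 7, 2] i : ZMod 8) ∈ block (![1, 3, 4] (column i) : ZMod 8) := by decide +kernel
  have h3 : ∀ i : Fin 6, ![p 1, p 3, p 6, p 5, p 7, p 2] i = p (![1, 3, 6, 5, 7, 2] i) := by
    intro i
    fin_cases i <;> rfl
  refine ⟨fun i => l (![0, 5, 7] i), fun i => l (![1, 3, 4] i), ⟨inj _ ?_, inj _ ?_, ?_, ?_⟩, ?_⟩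
  · decide +kernel
  · decide +kernel
  · exact fun i => ⟨(hl _ _).2 (h1 i).1, fun h' => (h1 i).2.1 ((hl _ _).1 h')⟩
  · exact fun i => ⟨(hl _ _).2 (h1 i).2.2.1, fun h' => (h1 i).2.2.2 ((hl _ _).1 h')⟩
  · intro i
    rw [h3]
    exact ⟨(hl _ _).2 (h2 i).1, (hl _ _).2 (h2 i).2⟩

variable [Fintype P]

theorem card_realizes_seven :
    #{p : ZMod 7 → P | Realizes L p} = #{K : Fin 4 → P | IsArc L K ∧ IsFano L K} := by
  refine card_bij (fun p _ => ![p 2, p 4, p 5, p 6]) ?_ ?_ ?_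
  · intro p hp
    simp only [mem_filter, mem_univ, true_and] at hp ⊢
    refine ⟨isArc_four_iff.2 ⟨hp.not_col 2 4 5 (by decide) (by decide),
      hp.not_col 2 4 6 (by decide) (by decide), hp.not_col 2 5 6 (by decide) (by decide),
      hp.not_col 4 5 6 (by decide) (by decide)⟩, p 0, hp.col 2 6 0 (by decide) (by decide),
      hp.col 4 5 0 (by decide) (by decide), p 1, p 3, hp.col 2 4 1 (by decide) (by decide),
      hp.col 5 6 1 (by decide) (by decide), hp.col 2 5 3 (by decide) (by decide),
      hp.col 4 6 3 (by decide) (by decide), hp.col 1 3 0 (by decide) (by decide)⟩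
  · intro p hp p' hp' heq
    simp only [mem_filter, mem_univ, true_and] at hp hp'
    obtain ⟨l, hl⟩ := (realizes_iff (.inl rfl)).1 hp
    obtain ⟨l', hl'⟩ := (realizes_iff (.inl rfl)).1 hp'
    have h2 : p 2 = p' 2 := congrFun heq 0
    have h4 : p 4 = p' 4 := congrFun heq 1
    have h5 : p 5 = p' 5 := congrFun heq 2
    have h6 : p 6 = p' 6 := congrFun heq 3
    have hlines : ∀ a i j, p i = p' i → p j = p' j → i ≠ j → i ∈ block a → j ∈ block a →
        l a = l' a := fun a i j hi hj hij hia hja =>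
      eq_of_mem (hp.1.ne hij) ((hl a i).2 hia) ((hl a j).2 hja) (hi ▸ (hl' a i).2 hia)
        (hj ▸ (hl' a j).2 hja)
    have hpoints : ∀ i a b, l a = l' a → l b = l' b → (∃ k, k ∈ block a ∧ k ∉ block b) →
        i ∈ block a → i ∈ block b → p i = p' i := by
      rintro i a b ha hb ⟨k, hka, hkb⟩ hia hib
      refine (eq_or_eq_of_mem ((hl a i).2 hia) (ha ▸ (hl' a i).2 hia) ((hl b i).2 hib)
        (hb ▸ (hl' b i).2 hib)).resolve_right fun hab => ?_
      exact hkb ((hl b k).1 (hab ▸ (hl a k).2 hka))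
    have l1 := hlines 1 2 4 h2 h4 (by decide) (by decide) (by decide)
    have l2 := hlines 2 2 5 h2 h5 (by decide) (by decide) (by decide)
    have l3 := hlines 3 4 6 h4 h6 (by decide) (by decide) (by decide)
    have l4 := hlines 4 4 5 h4 h5 (by decide) (by decide) (by decide)
    have l5 := hlines 5 5 6 h5 h6 (by decide) (by decide) (by decide)
    have l6 := hlines 6 2 6 h2 h6 (by decide) (by decide) (by decide)
    have h0 := hpoints 0 4 6 l4 l6 (by decide) (by decide) (by decide)
    have h1 := hpoints 1 1 5 l1 l5 (by decide) (by decide) (by decide)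
    have h3 := hpoints 3 2 3 l2 l3 (by decide) (by decide) (by decide)
    funext i
    fin_cases i
    exacts [h0, h1, h2, h3, h4, h5, h6]
  · intro K hK
    simp only [mem_filter, mem_univ, true_and] at hK
    obtain ⟨X, Y, Z, h⟩ := hK.1.exists_realizes hK.2
    refine ⟨_, by simpa using h, ?_⟩
    ext i
    fin_cases i <;> rfl

theorem card_realizes_eight :
    #{p : ZMod 8 → P | Realizes L p} =
      #{g : P × P × (Fin 6 → P) | Hexagon L g.1 g.2.1 g.2.2 ∧
        Col L (g.2.2 0) (g.2.2 2) (g.2.2 4) ∧ Col L (g.2.2 1) (g.2.2 3) (g.2.2 5)} := by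
  refine card_nbij' (fun p => (p 0, p 4, ![p 1, p 3, p 6, p 5, p 7, p 2]))
    (fun g => ![g.1, g.2.2 0, g.2.2 5, g.2.2 1, g.2.1, g.2.2 3, g.2.2 2, g.2.2 4]) ?_ ?_ ?_ ?_
  · intro p hp
    simp only [coe_filter, mem_univ, true_and, Set.mem_ofPred_eq] at hp ⊢
    exact ⟨hp.hexagon, hp.col 1 6 7 (by decide) (by decide), hp.col 3 5 2 (by decide) (by decide)⟩
  · intro g hg
    simp only [coe_filter, mem_univ, true_and, Set.mem_ofPred_eq] at hg ⊢
    exact hg.1.realizes hg.2.1 hg.2.2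
  · intro p _
    funext i
    fin_cases i <;> rfl
  · rintro ⟨X, Y, a⟩ -
    refine Prod.ext rfl (Prod.ext rfl (funext fun i => ?_))
    fin_cases i <;> rfl

variable [Finite L]

/-- The number of ordered eight-arcs in terms of the numbers of labelled Fano and Möbius–Kantor
configurations. -/
theorem numArcs_eight_eq :
    numArcs P L 8 =
      ((order P L : ℤ) ^ 2 + order P L + 1) * ((order P L : ℤ) ^ 2 + order P L) *
        (order P L : ℤ) ^ 2 * ((order P L : ℤ) - 1) ^ 2 * ((order P L : ℤ) - 5) *
        ((order P L : ℤ) ^ 7 - 43 * (order P L : ℤ) ^ 6 + 788 * (order P L : ℤ) ^ 5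
          - 7937 * (order P L : ℤ) ^ 4 + 47097 * (order P L : ℤ) ^ 3
          - 162834 * (order P L : ℤ) ^ 2 + 299280 * (order P L : ℤ) - 222960)
      - 8 * ((order P L : ℤ) ^ 2 - 20 * order P L + 78) *
        #{p : ZMod 7 → P | ∃ σ : Equiv.Perm (ZMod 7), Realizes L (p ∘ σ)} +
      #{p : ZMod 8 → P | ∃ σ : Equiv.Perm (ZMod 8), Realizes L (p ∘ σ)} := by
  have h7 := card_exists_realizes (P := P) (L := L) (n := 7) (.inl rfl)
  have h8 := card_exists_realizes (P := P) (L := L) (n := 8) (.inr rfl)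
  rw [card_preservesBlocks_seven, card_realizes_seven] at h7
  rw [card_preservesBlocks_eight, card_realizes_eight] at h8
  have f7 : Nat.factorial 7 = 5040 := rfl
  have f8 : Nat.factorial 8 = 40320 := rfl
  rw [f7] at h7
  rw [f8] at h8
  zify at h7 h8
  rw [numArcs_eight, card_conc_seven, card_conc_meeting_zero, card_conc_meeting_one,
    numArcs_seven, card_conc_six, numArcs_six, numArcs_five, numArcs_four]
  have e7 : (#{p : ZMod 7 → P | ∃ σ : Equiv.Perm (ZMod 7), Realizes L (p ∘ σ)} : ℤ) =
      30 * #{K : Fin 4 → P | IsArc L K ∧ IsFano L K} := by linarith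
  have e8 : (#{p : ZMod 8 → P | ∃ σ : Equiv.Perm (ZMod 8), Realizes L (p ∘ σ)} : ℤ) =
      840 * #{g : P × P × (Fin 6 → P) | Hexagon L g.1 g.2.1 g.2.2 ∧
        Col L (g.2.2 0) (g.2.2 2) (g.2.2 4) ∧ Col L (g.2.2 1) (g.2.2 3) (g.2.2 5)} := by linarith
  rw [e7, e8]
  ring

end Count

end Configuration

namespace ProjPlane

open Configuration ProjectivePlane

variable {q : ℕ} (Pl : ProjPlane q)

/-- The lines of `Pl`. -/
abbrev Line : Type := {ℓ : Set Pl.Point // ℓ ∈ Pl.L}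

instance : Fintype Pl.Point := Pl.fintypePoint

instance : Membership Pl.Point Pl.Line := ⟨fun ℓ p => p ∈ ℓ.1⟩

theorem line_eq {p₁ p₂ : Pl.Point} {l₁ l₂ : Pl.Line} (h : p₁ ≠ p₂) (h₁₁ : p₁ ∈ l₁) (h₂₁ : p₂ ∈ l₁)
    (h₁₂ : p₁ ∈ l₂) (h₂₂ : p₂ ∈ l₂) : l₁ = l₂ :=
  Subtype.ext ((Pl.unique_line p₁ p₂ h).unique ⟨l₁.2, h₁₁, h₂₁⟩ ⟨l₂.2, h₁₂, h₂₂⟩)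

theorem exists_line {p₁ p₂ : Pl.Point} (h : p₁ ≠ p₂) : ∃ l : Pl.Line, p₁ ∈ l ∧ p₂ ∈ l :=
  let ⟨l, hl, _⟩ := Pl.unique_line p₁ p₂ h
  ⟨⟨l, hl.1⟩, hl.2⟩

theorem exists_point {l₁ l₂ : Pl.Line} (h : l₁ ≠ l₂) : ∃ p : Pl.Point, p ∈ l₁ ∧ p ∈ l₂ :=
  let ⟨p, hp, _⟩ := Pl.unique_point l₁.1 l₂.1 l₁.2 l₂.2 fun h' => h (Subtype.ext h')
  ⟨p, hp⟩

theorem exists_four_points : ∃ a b c d : Pl.Point, a ≠ b ∧ a ≠ d ∧ c ≠ d ∧ a ≠ c ∧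
    ∀ l : Pl.Line, ¬ (a ∈ l ∧ b ∈ l ∧ c ∈ l) ∧ ¬ (a ∈ l ∧ b ∈ l ∧ d ∈ l) ∧
      ¬ (a ∈ l ∧ c ∈ l ∧ d ∈ l) ∧ ¬ (b ∈ l ∧ c ∈ l ∧ d ∈ l) := by
  obtain ⟨a, b, c, d, hab, hac, had, -, -, hcd, h⟩ := Pl.nondegenerate
  refine ⟨a, b, c, d, hab, had, hcd, hac, fun l => ?_⟩
  have h' := h l.1 l.2
  simp only [Set.insert_subset_iff, Set.singleton_subset_iff] at h'
  exact h'

noncomputable instance : ProjectivePlane Pl.Point Pl.Line where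
  exists_point l := by
    obtain ⟨a, b, c, d, -, -, -, -, h⟩ := Pl.exists_four_points
    by_contra! hl
    exact (h l).1 ⟨hl a, hl b, hl c⟩
  exists_line p := by
    obtain ⟨a, b, c, d, hab, had, hcd, hac, h⟩ := Pl.exists_four_points
    by_contra! hp
    obtain ⟨ab, ha, hb⟩ := Pl.exists_line hab
    obtain ⟨ac, ha', hc⟩ := Pl.exists_line hac
    obtain ⟨cd, hc', hd⟩ := Pl.exists_line hcd
    have hpa : p = a := by
      by_contra hne
      exact (h ac).1 ⟨ha', Pl.line_eq hne (hp ab) ha (hp ac) ha' ▸ hb, hc⟩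
    exact (h cd).2.2.1 ⟨hpa ▸ hp cd, hc', hd⟩
  eq_or_eq h₁₁ h₂₁ h₁₂ h₂₂ := or_iff_not_imp_left.2 fun h => Pl.line_eq h h₁₁ h₂₁ h₁₂ h₂₂
  mkPoint h := (Pl.exists_point h).choose
  mkPoint_ax h := (Pl.exists_point h).choose_spec
  mkLine h := (Pl.exists_line h).choose
  mkLine_ax h := (Pl.exists_line h).choose_spec
  exists_config := by
    obtain ⟨a, b, c, d, hab, had, hcd, hac, h⟩ := Pl.exists_four_points
    obtain ⟨ab, ha, hb⟩ := Pl.exists_line hab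
    obtain ⟨ad, ha', hd⟩ := Pl.exists_line had
    obtain ⟨cd, hc, hd'⟩ := Pl.exists_line hcd
    exact ⟨c, a, b, cd, ab, ad, fun h' => (h ab).1 ⟨ha, hb, h'⟩,
      fun h' => (h ad).2.2.1 ⟨ha', h', hd⟩, fun h' => (h cd).2.2.1 ⟨h', hc, hd'⟩, ha, ha',
      fun h' => (h cd).2.2.2 ⟨h', hc, hd'⟩, hb, fun h' => (h ad).2.1 ⟨ha', h', hd⟩⟩

theorem order_eq : order Pl.Point Pl.Line = q := by
  obtain ⟨a, b, -, -, hab, -⟩ := Pl.exists_four_points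
  obtain ⟨l, -⟩ := Pl.exists_line hab
  have h := pointCount_eq Pl.Point l
  rw [pointCount] at h
  have h' := Pl.line_card l.1 l.2
  rw [← Nat.card_coe_set_eq] at h'
  exact Nat.succ_injective (h.symm.trans h')

theorem collinear_iff {a b c : Pl.Point} : Pl.Collinear {a, b, c} ↔ Col Pl.Line a b c := by
  simp only [Collinear, Col, Set.insert_subset_iff, Set.singleton_subset_iff, Subtype.exists]
  exact exists_congr fun ℓ => ⟨fun ⟨h, h'⟩ => ⟨h, h'⟩, fun ⟨h, h'⟩ => ⟨h, h'⟩⟩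

theorem nArcs_eq (n : ℕ) : (Pl.nArcs n : ℤ) = numArcs Pl.Point Pl.Line n := by
  rw [nArcs, numArcs, Nat.card_eq_fintype_card, Fintype.card_subtype]
  congr 2
  exact Finset.filter_congr fun p _ => by simp only [collinear_iff, IsArc]

theorem card_realizes (n : ℕ) [NeZero n] :
    Nat.card {p : ZMod n → Pl.Point // Function.Injective p ∧
      ∃ σ : Equiv.Perm (ZMod n), ∀ i j k : ZMod n, i ≠ j → i ≠ k → j ≠ k →
        (Pl.Collinear {p (σ i), p (σ j), p (σ k)} ↔
          ∃ a : ZMod n, ({i, j, k} : Set (ZMod n)) = {a, a + 1, a + 3})} =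
      Finset.card
        {p : ZMod n → Pl.Point | ∃ σ : Equiv.Perm (ZMod n), Realizes Pl.Line (p ∘ σ)} := by
  rw [Nat.card_eq_fintype_card, Fintype.card_subtype]
  congr 1
  refine Finset.filter_congr fun p _ => ?_
  rw [← exists_and_left]
  refine exists_congr fun σ => and_congr (σ.injective_comp p).symm ?_
  simp only [collinear_iff, Function.comp_apply, block, ← Finset.coe_inj, Finset.coe_insert,
    Finset.coe_singleton]

end ProjPlane

/-- Glynn's formula for the number of ordered 8-arcs in any finite projective
plane of order `q`, in terms of the numbers of strong realizations of the
Fano plane and of the Möbius–Kantor configuration. -/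
theorem count_eight_arcs (q : ℕ) (Pl : ProjPlane q) :
    (Pl.nArcs 8 : ℤ) =
      ((q : ℤ) ^ 2 + q + 1) * ((q : ℤ) ^ 2 + q) * (q : ℤ) ^ 2 * ((q : ℤ) - 1) ^ 2 *
        ((q : ℤ) - 5) *
        ((q : ℤ) ^ 7 - 43 * (q : ℤ) ^ 6 + 788 * (q : ℤ) ^ 5 - 7937 * (q : ℤ) ^ 4
          + 47097 * (q : ℤ) ^ 3 - 162834 * (q : ℤ) ^ 2 + 299280 * (q : ℤ) - 222960)
      - 8 * ((q : ℤ) ^ 2 - 20 * q + 78) * (Pl.A7 : ℤ) + (Pl.A8 : ℤ) := by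
  rw [Pl.nArcs_eq, Configuration.numArcs_eight_eq, Pl.order_eq, ProjPlane.A7, ProjPlane.A8,
    Pl.card_realizes, Pl.card_realizes]
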